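/- arXiv:1807.11620 — 4 statements merged into one kernel-verified Lean document; each statement's English description precedes it below -/
import Mathlib

section
/- Let P be a set of probability distributions on ℝ whose diameter under the KS distance is d_L, i.e. sup_{p,p'∈P} d_KS(p,p') = d_L. Let x₁ and x₂ be independent sequences of n i.i.d. samples drawn from p₁ ∈ P and p₂ ∈ P respectively. Then for every d₀ > d_L, P(d_KS(x₁,x₂) > d₀) ≤ 4·exp(−n(d₀ − d_L)²/2). -/
open MeasureTheory
open scoped Classical

/-- Empirical c.d.f. of a sequence of `n` real samples. -/
noncomputable def empCDF {n : ℕ} (x : Fin n → ℝ) (a : ℝ) : ℝ :=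
  (Finset.univ.filter fun i => x i ≤ a).card / (n : ℝ)

/-- KS distance between the empirical c.d.f.'s of two sequences. -/
noncomputable def ksDistSeq {n : ℕ} (x y : Fin n → ℝ) : ℝ :=
  ⨆ a : ℝ, |empCDF x a - empCDF y a|

/-- c.d.f. of a measure on ℝ. -/
noncomputable def cdfOf (p : Measure ℝ) (a : ℝ) : ℝ := (p (Set.Iic a)).toReal

/-- KS distance between two distributions on ℝ. -/
noncomputable def ksDist (p q : Measure ℝ) : ℝ :=
  ⨆ a : ℝ, |cdfOf p a - cdfOf q a|

lemma card_symmDiff_add_two_mul_card_inter {ι : Type*} (s t : Finset ι) :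
    (symmDiff s t).card + 2 * (s ∩ t).card = s.card + t.card := by
  have h1 : (symmDiff s t).card = (s \ t).card + (t \ s).card := by
    rw [symmDiff_def, Finset.sup_eq_union, Finset.card_union_of_disjoint]
    exact disjoint_sdiff_sdiff
  have h2 := Finset.card_sdiff_add_card_inter s t
  have h3 := Finset.card_sdiff_add_card_inter t s
  rw [Finset.inter_comm t s] at h3
  omega

section Reflection

variable {ι : Type*} [Fintype ι]

/-- Reflection principle for subsets of fixed size along a chain of sets. -/
lemma card_exists_symmDiff_le (S : Finset ι) {P : ℕ → Finset ι} (hP : Monotone P)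
    (hPS : ∀ j, P j ⊆ S) (n k : ℕ) :
    (Finset.univ.filter fun A : Finset ι =>
        A.card = n ∧ ∃ j, (symmDiff A (P j) ∩ S).card = k).card
      ≤ (Finset.univ.filter fun A : Finset ι => (A ∩ S).card = k).card := by
  have key : ∀ A B : Finset ι, ∀ a b : ℕ, a < b → A.card = n → B.card = n →
      symmDiff A (P a) = symmDiff B (P b) →
      (symmDiff B (P a) ∩ S).card = (symmDiff A (P a) ∩ S).card := by
    intro A B a b hab hA hB h
    have hab' := hP hab.le
    set D := P b \ P a with hD
    have hB' : B = symmDiff A D := by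
      have : B = symmDiff (symmDiff A (P a)) (P b) := by rw [h, symmDiff_symmDiff_cancel_right]
      rw [this]
      ext i
      have := @hab' i
      simp only [Finset.mem_symmDiff, hD, Finset.mem_sdiff]
      tauto
    have h1 : symmDiff B (P a) ∩ S = symmDiff (symmDiff A (P a) ∩ S) D := by
      rw [hB']
      ext i
      have := @hPS b i
      have := @hab' i
      simp only [Finset.mem_symmDiff, hD, Finset.mem_sdiff, Finset.mem_inter]
      tauto
    have h2 : (symmDiff A (P a) ∩ S) ∩ D = A ∩ D := by
      ext i
      have := @hPS b i
      simp only [Finset.mem_symmDiff, hD, Finset.mem_sdiff, Finset.mem_inter]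
      tauto
    have h3 := card_symmDiff_add_two_mul_card_inter A D
    have h4 := card_symmDiff_add_two_mul_card_inter (symmDiff A (P a) ∩ S) D
    rw [← hB'] at h3
    rw [← h1, h2] at h4
    omega
  let τ : Finset ι → ℕ := fun A =>
    if h : ∃ j, (symmDiff A (P j) ∩ S).card = k then Nat.find h else 0
  have hτ : ∀ A, (∃ j, (symmDiff A (P j) ∩ S).card = k) →
      (symmDiff A (P (τ A)) ∩ S).card = k := by
    intro A h
    simp only [τ, dif_pos h]
    exact Nat.find_spec h
  have hmin : ∀ A, ∀ j < τ A, (symmDiff A (P j) ∩ S).card ≠ k := by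
    intro A j hj
    by_cases h : ∃ j, (symmDiff A (P j) ∩ S).card = k
    · simp only [τ, dif_pos h] at hj
      exact Nat.find_min h hj
    · simp [τ, dif_neg h] at hj
  refine Finset.card_le_card_of_injOn (fun A => symmDiff A (P (τ A))) ?_ ?_
  · intro A hA
    simp only [Finset.coe_filter, Finset.mem_univ, true_and, Set.mem_ofPred_eq] at hA ⊢
    exact hτ A hA.2
  · intro A hA B hB hAB
    simp only [Finset.coe_filter, Finset.mem_univ, true_and, Set.mem_ofPred_eq] at hA hB hAB
    rcases lt_trichotomy (τ A) (τ B) with h | h | h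
    · exact absurd ((key A B _ _ h hA.1 hB.1 hAB).trans (hτ A hA.2)) (hmin B _ h)
    · rw [h] at hAB
      exact symmDiff_left_injective _ hAB
    · exact absurd ((key B A _ _ h hB.1 hA.1 hAB.symm).trans (hτ B hB.2)) (hmin A _ h)

/-- Sublevel sets of a real function on a finite type extend to a chain adding one point at a
time. -/
lemma exists_chain_sublevel (w : ι → ℝ) (T : ℝ) :
    ∃ P : ℕ → Finset ι, Monotone P ∧ P 0 = ∅ ∧
      (∀ j, P j ⊆ Finset.univ.filter fun i => w i ≤ T) ∧
      (∀ j, (P (j + 1) \ P j).card ≤ 1) ∧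
      ∀ t ≤ T, ∃ j, P j = Finset.univ.filter fun i => w i ≤ t := by
  let e := Fintype.equivFin ι
  let key : ι → ℝ ×ₗ (Fin (Fintype.card ι)) := fun i => toLex (w i, e i)
  have hkey : Function.Injective key := by
    intro a b h
    have := congrArg (fun z => (ofLex z).2) h
    simpa [key] using this
  let ρ : ι → ℕ := fun i => (Finset.univ.filter fun i' => key i' < key i).card
  have hlt : ∀ a b, key a < key b → ρ a < ρ b := by
    intro a b h
    apply Finset.card_lt_card
    refine ⟨fun i hi => ?_, fun hh => ?_⟩
    · simp only [Finset.mem_filter, Finset.mem_univ, true_and] at hi ⊢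
      exact hi.trans h
    · have := hh (show a ∈ _ by simpa using h)
      simp at this
  have hρ : Function.Injective ρ := by
    intro a b h
    rcases lt_trichotomy (key a) (key b) with h' | h' | h'
    · exact absurd h (hlt _ _ h').ne
    · exact hkey h'
    · exact absurd h (hlt _ _ h').ne'
  refine ⟨fun j => Finset.univ.filter fun i => w i ≤ T ∧ ρ i < j, ?_, by simp, ?_, ?_, ?_⟩
  · intro a b hab i hi
    simp only [Finset.mem_filter, Finset.mem_univ, true_and] at hi ⊢
    exact ⟨hi.1, hi.2.trans_le hab⟩
  · intro j i hi
    simp only [Finset.mem_filter, Finset.mem_univ, true_and] at hi ⊢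
    exact hi.1
  · intro j
    rw [Finset.card_le_one]
    intro a ha b hb
    simp only [Finset.mem_sdiff, Finset.mem_filter, Finset.mem_univ, true_and, not_and] at ha hb
    have := ha.2 ha.1.1
    have := hb.2 hb.1.1
    exact hρ (by omega)
  · intro t ht
    refine ⟨(Finset.univ.filter fun i => w i ≤ t).card, ?_⟩
    ext i
    simp only [Finset.mem_filter, Finset.mem_univ, true_and]
    constructor
    · rintro ⟨h1, h2⟩
      by_contra! h3
      refine absurd h2 (not_lt.2 (Finset.card_le_card fun i' hi' => ?_))
      simp only [Finset.mem_filter, Finset.mem_univ, true_and] at hi' ⊢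
      exact Prod.Lex.toLex_lt_toLex.2 (Or.inl (hi'.trans_lt h3))
    · intro h
      refine ⟨h.trans ht, Finset.card_lt_card ⟨fun i' hi' => ?_, fun hh => ?_⟩⟩
      · simp only [Finset.mem_filter, Finset.mem_univ, true_and] at hi' ⊢
        rcases Prod.Lex.toLex_lt_toLex.1 hi' with h' | h'
        · exact h'.le.trans h
        · exact h'.1.le.trans h
      · have := hh (show i ∈ _ by simpa using h)
        simp at this

/-- Points of `A` in `(t, T]` together with points outside `A` in `(-∞, t]`. -/
noncomputable def splitCount (T : ℝ) (A : Finset ι) (w : ι → ℝ) (t : ℝ) : ℕ :=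
  (A.filter fun i => t < w i ∧ w i ≤ T).card + (Aᶜ.filter fun i => w i ≤ t).card

/-- The split count starts above `k` and reaches level `k` at one of the points. -/
def splitEvent (T : ℝ) (k : ℕ) (A : Finset ι) : Set (ι → ℝ) :=
  {w | k < (A.filter fun i => w i ≤ T).card ∧ ∃ j, w j ≤ T ∧ splitCount T A w (w j) ≤ k}

lemma splitCount_eq {T t : ℝ} (ht : t ≤ T) (A : Finset ι) (w : ι → ℝ) :
    splitCount T A w t = (symmDiff A (Finset.univ.filter fun i => w i ≤ t) ∩
      Finset.univ.filter fun i => w i ≤ T).card := by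
  rw [splitCount, ← Finset.card_union_of_disjoint]
  · congr 1
    ext i
    simp only [Finset.mem_union, Finset.mem_filter, Finset.mem_compl, Finset.mem_inter,
      Finset.mem_symmDiff, Finset.mem_univ, true_and]
    have : w i ≤ t → w i ≤ T := fun h => h.trans ht
    have := not_le (a := w i) (b := t)
    tauto
  · rw [Finset.disjoint_left]
    intro i hi hi'
    simp only [Finset.mem_filter, Finset.mem_compl] at hi hi'
    exact hi'.1 hi.1

lemma card_mem_splitEvent_le (w : ι → ℝ) (T : ℝ) (n k : ℕ) :
    (Finset.univ.filter fun A : Finset ι => A.card = n ∧ w ∈ splitEvent T k A).card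
      ≤ (Finset.univ.filter fun A : Finset ι =>
          (A ∩ Finset.univ.filter fun i => w i ≤ T).card = k).card := by
  obtain ⟨P, hP, hP0, hPS, hstep, hex⟩ := exists_chain_sublevel w T
  refine (Finset.card_le_card fun A hA => ?_).trans (card_exists_symmDiff_le _ hP hPS n k)
  simp only [Finset.mem_filter, Finset.mem_univ, true_and] at hA ⊢
  obtain ⟨hAn, hk, j, hjT, hj⟩ := hA
  refine ⟨hAn, ?_⟩
  set S := Finset.univ.filter fun i => w i ≤ T with hS
  have hle : ∃ l, (symmDiff A (P l) ∩ S).card ≤ k := by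
    obtain ⟨l, hl⟩ := hex _ hjT
    exact ⟨l, by rw [hl, ← splitCount_eq hjT]; exact hj⟩
  refine ⟨Nat.find hle, le_antisymm (Nat.find_spec hle) ?_⟩
  have h0 : k < (symmDiff A (P 0) ∩ S).card := by
    have : symmDiff A (P 0) ∩ S = A.filter fun i => w i ≤ T := by
      ext i; simp [hP0, hS, Finset.mem_symmDiff]
    rwa [this]
  obtain ⟨l, hl⟩ : ∃ l, Nat.find hle = l + 1 := by
    refine Nat.exists_eq_succ_of_ne_zero fun h => ?_
    have := Nat.find_spec hle
    rw [h] at this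
    omega
  have hmin := not_le.1 (Nat.find_min hle (show l < Nat.find hle by omega))
  have hsub : symmDiff A (P l) ∩ S ⊆ (symmDiff A (P (l + 1)) ∩ S) ∪ (P (l + 1) \ P l) := by
    intro i hi
    have := @hP l (l + 1) l.le_succ i
    simp only [Finset.mem_symmDiff, Finset.mem_sdiff, Finset.mem_inter, Finset.mem_union] at hi ⊢
    tauto
  have h1 := (Finset.card_le_card hsub).trans (Finset.card_union_le _ _)
  have h2 := hstep l
  rw [hl]
  omega

lemma measurableSet_splitEvent (T : ℝ) (k : ℕ) (A : Finset ι) :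
    MeasurableSet (splitEvent T k A) := by
  have hm : ∀ i : ι, Measurable fun w : ι → ℝ => w i := fun i => measurable_pi_apply i
  have h1 : Measurable fun w : ι → ℝ => (A.filter fun i => w i ≤ T).card := by
    simp only [Finset.card_filter]
    exact Finset.measurable_sum _ fun i _ =>
      Measurable.ite (measurableSet_le (hm i) measurable_const) measurable_const measurable_const
  have h2 : ∀ j, Measurable fun w : ι → ℝ => splitCount T A w (w j) := by
    intro j
    simp only [splitCount, Finset.card_filter]
    refine Measurable.add (Finset.measurable_sum _ fun i _ => ?_)
      (Finset.measurable_sum _ fun i _ => ?_)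
    · exact Measurable.ite ((measurableSet_lt (hm j) (hm i)).inter
        (measurableSet_le (hm i) measurable_const)) measurable_const measurable_const
    · exact Measurable.ite (measurableSet_le (hm i) (hm j)) measurable_const measurable_const
  have : splitEvent T k A = {w | k < (A.filter fun i => w i ≤ T).card} ∩
      ⋃ j, ({w | w j ≤ T} ∩ {w | splitCount T A w (w j) ≤ k}) := by
    ext w
    simp [splitEvent]
  rw [this]
  exact (measurableSet_lt measurable_const h1).inter (MeasurableSet.iUnion fun j =>
    (measurableSet_le (hm j) measurable_const).inter (measurableSet_le (h2 j) measurable_const))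

lemma mem_splitEvent_map_iff (T : ℝ) (k : ℕ) (A : Finset ι) (e : Equiv.Perm ι) (w : ι → ℝ) :
    w ∈ splitEvent T k (A.map e.toEmbedding) ↔ (fun i => w (e i)) ∈ splitEvent T k A := by
  have h : (A.map e.toEmbedding)ᶜ = Aᶜ.map e.toEmbedding := by
    ext i
    simp [Finset.mem_map_equiv]
  simp only [splitEvent, splitCount, Set.mem_ofPred_eq, h, Finset.filter_map, Finset.card_map,
    Function.comp_def, Equiv.coe_toEmbedding]
  rw [e.surjective.exists]

lemma measure_splitEvent_eq (ν : Measure ℝ) [IsProbabilityMeasure ν] (T : ℝ) (k : ℕ)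
    {A B : Finset ι} (h : A.card = B.card) :
    (Measure.pi fun _ : ι => ν) (splitEvent T k A)
      = (Measure.pi fun _ : ι => ν) (splitEvent T k B) := by
  obtain ⟨e, he⟩ : ∃ e : Equiv.Perm ι, B = A.map e.toEmbedding := by
    let f : {i // i ∈ A} ≃ {i // i ∈ B} := Fintype.equivOfCardEq (by simpa using h)
    refine ⟨f.extendSubtype, ?_⟩
    symm
    apply Finset.eq_of_subset_of_card_le
    · intro i hi
      obtain ⟨a, ha, rfl⟩ := Finset.mem_map.1 hi
      exact f.extendSubtype_mem a ha
    · rw [Finset.card_map, h]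
  have hmp := measurePreserving_piCongrLeft (fun _ : ι => ν) e
  rw [← hmp.measure_preimage (measurableSet_splitEvent T k B).nullMeasurableSet]
  congr 1
  ext w
  rw [Set.mem_preimage, he, mem_splitEvent_map_iff]
  have : (fun i => (MeasurableEquiv.piCongrLeft (fun _ : ι => ℝ) e w) (e i)) = w := by
    funext i
    exact MeasurableEquiv.piCongrLeft_apply_apply (β := fun _ => ℝ) e w i
  rw [this]

lemma card_inter_eq_le (S : Finset ι) (k : ℕ) :
    (Finset.univ.filter fun A : Finset ι => (A ∩ S).card = k).card
      ≤ S.card.choose k * 2 ^ (Fintype.card ι - S.card) := by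
  rw [← Finset.card_powersetCard, ← Finset.card_compl, ← Finset.card_powerset,
    ← Finset.card_product]
  refine Finset.card_le_card_of_injOn (fun A => (A ∩ S, A \ S)) ?_ ?_
  · intro A hA
    simp only [Finset.coe_filter, Finset.mem_univ, true_and, Set.mem_ofPred_eq] at hA
    simp only [Finset.coe_product, Set.mem_prod, Finset.mem_coe, Finset.mem_powersetCard,
      Finset.mem_powerset]
    refine ⟨⟨Finset.inter_subset_right, hA⟩, fun i hi => ?_⟩
    simpa using (Finset.mem_sdiff.1 hi).2
  · intro A _ B _ h
    simp only [Prod.mk.injEq] at h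
    rw [← Finset.sdiff_union_inter A S, ← Finset.sdiff_union_inter B S, h.1, h.2]

lemma measureReal_filter_le_eq (ν : Measure ℝ) [IsProbabilityMeasure ν] (T : ℝ) (S : Finset ι) :
    (Measure.pi fun _ : ι => ν).real {w | (Finset.univ.filter fun i => w i ≤ T) = S}
      = ν.real (Set.Iic T) ^ S.card * (1 - ν.real (Set.Iic T)) ^ (Fintype.card ι - S.card) := by
  have h1 : {w : ι → ℝ | (Finset.univ.filter fun i => w i ≤ T) = S}
      = Set.pi Set.univ fun i => if i ∈ S then Set.Iic T else Set.Ioi T := by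
    ext w
    simp only [Set.mem_ofPred_eq, Set.mem_pi, Set.mem_univ, true_implies, Finset.ext_iff,
      Finset.mem_filter, Finset.mem_univ, true_and]
    refine forall_congr' fun i => ?_
    by_cases hi : i ∈ S <;> simp [hi]
  have h2 : ν.real (Set.Ioi T) = 1 - ν.real (Set.Iic T) := by
    rw [← Set.compl_Iic, probReal_compl_eq_one_sub measurableSet_Iic]
  rw [h1, Measure.real, Measure.pi_pi, ENNReal.toReal_prod, ← h2, ← Finset.card_compl,
    ← Finset.prod_const, ← Finset.prod_const, ← Finset.prod_mul_prod_compl S]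
  congr 1
  · exact Finset.prod_congr rfl fun i hi => by simp [hi, Measure.real]
  · exact Finset.prod_congr rfl fun i hi => by simp [Finset.mem_compl.1 hi, Measure.real]

lemma sum_choose_mul_choose (N k : ℕ) (hk : k ≤ N) (p : ℝ) :
    ∑ j ∈ Finset.range (N + 1),
        (N.choose j : ℝ) * (p ^ j * (1 - p) ^ (N - j) * (j.choose k * 2 ^ (N - j)))
      = N.choose k * p ^ k * (2 - p) ^ (N - k) := by
  have h1 : (2 - p) ^ (N - k) = (p + 2 * (1 - p)) ^ (N - k) := by ring
  rw [h1, add_pow, Finset.mul_sum]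
  have h2 : N + 1 = k + (N - k + 1) := by omega
  rw [h2, Finset.sum_range_add, Finset.sum_eq_zero, zero_add]
  · refine Finset.sum_congr rfl fun j _ => ?_
    have h3 := Nat.choose_mul (n := N) (Nat.le_add_right k j)
    rw [Nat.add_sub_cancel_left] at h3
    have h4 : (N.choose (k + j) : ℝ) * (k + j).choose k = N.choose k * (N - k).choose j := by
      exact_mod_cast h3
    have h5 : N - (k + j) = N - k - j := by omega
    rw [h5, mul_pow, pow_add]
    linear_combination (p ^ k * p ^ j * (1 - p) ^ (N - k - j) * 2 ^ (N - k - j)) * h4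
  · intro j hj
    rw [Nat.choose_eq_zero_of_lt (Finset.mem_range.1 hj)]
    simp

lemma choose_mul_measureReal_splitEvent_le (ν : Measure ℝ) [IsProbabilityMeasure ν] (T : ℝ)
    {k : ℕ} (hk : k ≤ Fintype.card ι) (A : Finset ι) :
    (Fintype.card ι).choose A.card * (Measure.pi fun _ : ι => ν).real (splitEvent T k A)
      ≤ (Fintype.card ι).choose k * ν.real (Set.Iic T) ^ k *
        (2 - ν.real (Set.Iic T)) ^ (Fintype.card ι - k) := by
  set μ := Measure.pi fun _ : ι => ν
  set N := Fintype.card ι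
  set E : Finset ι → Set (ι → ℝ) := fun S => {w | (Finset.univ.filter fun i => w i ≤ T) = S}
  have hE : ∀ S, MeasurableSet (E S) := by
    intro S
    have : E S = ⋂ i, {w | w i ≤ T ↔ i ∈ S} := by
      ext w
      simp [E, Finset.ext_iff]
    rw [this]
    refine MeasurableSet.iInter fun i => ?_
    by_cases hi : i ∈ S
    · simpa [hi] using measurableSet_le (measurable_pi_apply i) measurable_const
    · simpa [hi] using measurableSet_lt measurable_const (measurable_pi_apply i)
  have h1 : (N.choose A.card : ℝ) * μ.real (splitEvent T k A)
      = ∑ B ∈ Finset.powersetCard A.card Finset.univ, μ.real (splitEvent T k B) := by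
    rw [Finset.sum_congr rfl fun B hB => show μ.real (splitEvent T k B)
      = μ.real (splitEvent T k A) from congrArg ENNReal.toReal
        (measure_splitEvent_eq ν T k (Finset.mem_powersetCard.1 hB).2)]
    rw [Finset.sum_const, Finset.card_powersetCard, Finset.card_univ, nsmul_eq_mul]
  have hint : ∀ (s : Set (ι → ℝ)) (c : ℝ), MeasurableSet s →
      Integrable (s.indicator fun _ => c) μ :=
    fun s c hs => (integrable_const c).indicator hs
  have h2 : ∑ B ∈ Finset.powersetCard A.card Finset.univ, μ.real (splitEvent T k B)
      = ∫ w, ∑ B ∈ Finset.powersetCard A.card Finset.univ,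
          (splitEvent T k B).indicator (fun _ => (1 : ℝ)) w ∂μ := by
    rw [integral_finsetSum _ fun B _ => hint _ _ (measurableSet_splitEvent T k B)]
    refine Finset.sum_congr rfl fun B _ => ?_
    rw [integral_indicator_const _ (measurableSet_splitEvent T k B)]
    simp
  have h3 : ∫ w, ∑ B ∈ Finset.powersetCard A.card Finset.univ,
          (splitEvent T k B).indicator (fun _ => (1 : ℝ)) w ∂μ
      ≤ ∫ w, ∑ S : Finset ι, (E S).indicator
          (fun _ => (S.card.choose k * 2 ^ (N - S.card) : ℝ)) w ∂μ := by
    refine integral_mono (integrable_finsetSum _ fun B _ =>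
      hint _ _ (measurableSet_splitEvent T k B))
      (integrable_finsetSum _ fun S _ => hint _ _ (hE S)) fun w => ?_
    have h4 := (card_mem_splitEvent_le w T A.card k).trans (card_inter_eq_le _ k)
    have h5 : ∑ S : Finset ι, (E S).indicator
          (fun _ => (S.card.choose k * 2 ^ (N - S.card) : ℝ)) w
        = ((Finset.univ.filter fun i => w i ≤ T).card.choose k *
          2 ^ (N - (Finset.univ.filter fun i => w i ≤ T).card) : ℝ) := by
      rw [Finset.sum_eq_single (Finset.univ.filter fun i => w i ≤ T)]
      · rw [Set.indicator_of_mem]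
        rfl
      · intro S _ hS
        exact Set.indicator_of_notMem (fun h => hS h.symm) _
      · simp
    simp only [h5]
    have h6 : ∑ B ∈ Finset.powersetCard A.card Finset.univ,
          (splitEvent T k B).indicator (fun _ => (1 : ℝ)) w
        = ((Finset.univ.filter fun B : Finset ι =>
            B.card = A.card ∧ w ∈ splitEvent T k B).card : ℝ) := by
      have : (Finset.univ.filter fun B : Finset ι => B.card = A.card ∧ w ∈ splitEvent T k B)
          = (Finset.powersetCard A.card Finset.univ).filter fun B => w ∈ splitEvent T k B := by
        ext B
        simp [Finset.mem_powersetCard]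
      rw [this, Finset.card_filter]
      push_cast
      rfl
    rw [h6]
    exact_mod_cast h4
  have h7 : ∫ w, ∑ S : Finset ι, (E S).indicator
          (fun _ => (S.card.choose k * 2 ^ (N - S.card) : ℝ)) w ∂μ
      = ∑ j ∈ Finset.range (N + 1), (N.choose j : ℝ) * (ν.real (Set.Iic T) ^ j *
          (1 - ν.real (Set.Iic T)) ^ (N - j) * (j.choose k * 2 ^ (N - j))) := by
    rw [integral_finsetSum _ fun S _ => hint _ _ (hE S), ← Finset.powerset_univ]
    rw [Finset.sum_congr rfl fun S _ => show _ = ν.real (Set.Iic T) ^ S.card *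
          (1 - ν.real (Set.Iic T)) ^ (N - S.card) * (S.card.choose k * 2 ^ (N - S.card)) by
        rw [integral_indicator_const _ (hE S), measureReal_filter_le_eq, smul_eq_mul]]
    rw [Finset.sum_powerset_apply_card (fun j => ν.real (Set.Iic T) ^ j *
          (1 - ν.real (Set.Iic T)) ^ (N - j) * (j.choose k * 2 ^ (N - j)))]
    simp [N]
  rw [h1, h2, ← sum_choose_mul_choose N k hk, ← h7]
  exact h3

lemma exp_neg_le_one_sub_add_sq {x : ℝ} (hx : 0 ≤ x) : Real.exp (-x) ≤ 1 - x + x ^ 2 / 2 := by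
  rw [Real.exp_neg, inv_le_iff_one_le_mul₀ (Real.exp_pos x)]
  have h1 := Real.quadratic_le_exp_of_nonneg hx
  have h2 : 0 ≤ 1 - x + x ^ 2 / 2 := by nlinarith [sq_nonneg (x - 1)]
  nlinarith [mul_le_mul_of_nonneg_left h1 h2,
    sq_nonneg (x ^ 2)]

/-- Lower tail bound for the number of points of an i.i.d. family in a half-line. -/
lemma measureReal_card_filter_le (ν : Measure ℝ) [IsProbabilityMeasure ν] (T : ℝ) (k : ℕ)
    (A : Finset ι) {δ : ℝ} (hδ : 0 ≤ δ) (hk : (k : ℝ) ≤ A.card * (ν.real (Set.Iic T) - δ)) :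
    (Measure.pi fun _ : ι => ν).real {w | (A.filter fun i => w i ≤ T).card ≤ k}
      ≤ Real.exp (-(A.card * δ ^ 2) / 2) := by
  set μ := Measure.pi fun _ : ι => ν
  set p := ν.real (Set.Iic T) with hp
  have hp0 : 0 ≤ p := measureReal_nonneg
  have hp1 : p ≤ 1 := measureReal_le_one
  let f : ι → ℝ → ℝ := fun i x => if i ∈ A ∧ x ≤ T then Real.exp (-δ) else 1
  have hf : ∀ i, ∫ x, f i x ∂ν = if i ∈ A then 1 - p + p * Real.exp (-δ) else 1 := by
    intro i
    by_cases hi : i ∈ A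
    · have : f i = fun x => 1 + (Set.Iic T).indicator (fun _ => Real.exp (-δ) - 1) x := by
        funext x
        by_cases hx : x ≤ T <;> simp [f, hi, hx]
      rw [this, integral_add (integrable_const _)
        ((integrable_const _).indicator measurableSet_Iic),
        integral_indicator_const _ measurableSet_Iic]
      simp [hi, ← hp]
      ring
    · simp [f, hi]
  have hprod : ∀ w : ι → ℝ, ∏ i, f i (w i)
      = Real.exp (-δ) ^ (A.filter fun i => w i ≤ T).card := by
    intro w
    rw [← Finset.prod_const, Finset.prod_filter, ← Finset.prod_subset (Finset.subset_univ A)]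
    · exact Finset.prod_congr rfl fun i hi => by simp [f, hi]
    · intro i _ hi
      simp [f, hi]
  have hint : Integrable (fun w : ι → ℝ => ∏ i, f i (w i)) μ := by
    refine Integrable.fintype_prod fun i => ?_
    by_cases hi : i ∈ A
    · have : f i = fun x => 1 + (Set.Iic T).indicator (fun _ => Real.exp (-δ) - 1) x := by
        funext x
        by_cases hx : x ≤ T <;> simp [f, hi, hx]
      rw [this]
      exact (integrable_const _).add ((integrable_const _).indicator measurableSet_Iic)
    · have : f i = fun _ => 1 := by funext x; simp [f, hi]
      rw [this]
      exact integrable_const _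
  have hmarkov := mul_meas_ge_le_integral_of_nonneg (μ := μ)
    (Filter.Eventually.of_forall fun w => Finset.prod_nonneg fun i _ => by
      simp only [f]; split_ifs <;> positivity) hint (Real.exp (-δ) ^ k)
  have hsub : {w : ι → ℝ | (A.filter fun i => w i ≤ T).card ≤ k}
      ⊆ {w | Real.exp (-δ) ^ k ≤ ∏ i, f i (w i)} := by
    intro w hw
    simp only [Set.mem_ofPred_eq] at hw ⊢
    rw [hprod]
    exact pow_le_pow_of_le_one (Real.exp_pos _).le (by simpa using hδ) hw
  have h1 := measureReal_mono (μ := μ) hsub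
  have h2 : ∫ w, ∏ i, f i (w i) ∂μ = (1 - p + p * Real.exp (-δ)) ^ A.card := by
    rw [integral_fintype_prod_eq_prod]
    simp only [hf]
    rw [Finset.prod_ite_mem, Finset.univ_inter, Finset.prod_const]
  rw [h2] at hmarkov
  have h3 : (1 - p + p * Real.exp (-δ)) ^ A.card
      ≤ Real.exp (A.card * (p * (-δ + δ ^ 2 / 2))) := by
    rw [Real.exp_nat_mul]
    refine pow_le_pow_left₀ (by positivity [sub_nonneg.2 hp1]) ?_ _
    refine le_trans ?_ (Real.add_one_le_exp _)
    nlinarith [exp_neg_le_one_sub_add_sq hδ]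
  have h4 : Real.exp (-δ) ^ k = Real.exp (k * (-δ)) := (Real.exp_nat_mul _ _).symm
  rw [h4] at hmarkov h1
  have h5 : μ.real {w | Real.exp (k * (-δ)) ≤ ∏ i, f i (w i)}
      ≤ Real.exp (A.card * (p * (-δ + δ ^ 2 / 2)) + k * δ) := by
    rw [Real.exp_add, ← div_le_iff₀ (Real.exp_pos _), div_eq_mul_inv, ← Real.exp_neg, mul_comm,
      ← mul_neg]
    exact hmarkov.trans h3
  refine h1.trans (h5.trans (Real.exp_le_exp.2 ?_))
  have h6 := mul_le_mul_of_nonneg_right hk hδ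
  have h7 : 0 ≤ (A.card : ℝ) * δ ^ 2 * (1 - p) := by
    have := sub_nonneg.2 hp1
    positivity
  nlinarith

end Reflection

lemma integral_bernsteinPolynomial {N k : ℕ} (hk : k ≤ N) :
    ∫ x in (0 : ℝ)..1, (bernsteinPolynomial ℝ N k).eval x = 1 / (N + 1) := by
  induction hk using Nat.decreasingInduction with
  | self =>
    simp [bernsteinPolynomial, integral_pow]
  | of_succ k hk ih =>
    have hint : ∀ p : Polynomial ℝ, IntervalIntegrable (fun x => p.eval x) volume 0 1 :=
      fun p => p.continuous.intervalIntegrable _ _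
    have h := intervalIntegral.integral_eq_sub_of_hasDerivAt (a := 0) (b := 1)
      (fun x _ => (bernsteinPolynomial ℝ (N + 1) (k + 1)).hasDerivAt x) (hint _)
    rw [bernsteinPolynomial.derivative_succ_aux] at h
    have h0 : (0 : ℕ) < N - k := Nat.sub_pos_of_lt hk
    simp only [Polynomial.eval_mul, Polynomial.eval_sub, Polynomial.eval_add,
      Polynomial.eval_natCast, Polynomial.eval_one, bernsteinPolynomial.eval_at_0,
      bernsteinPolynomial.eval_at_1] at h
    rw [intervalIntegral.integral_const_mul, intervalIntegral.integral_sub (hint _) (hint _), ih,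
      if_neg (by omega), if_neg (by omega), sub_zero] at h
    have h1 : (N : ℝ) + 1 ≠ 0 := by positivity
    have := (mul_eq_zero.1 h).resolve_left h1
    linarith

lemma integral_choose_mul_pow_mul_two_sub_pow {N k : ℕ} (hk : k ≤ N) :
    ∫ x in (0 : ℝ)..2, (N.choose k : ℝ) * (x ^ k * (2 - x) ^ (N - k)) = 2 ^ (N + 1) / (N + 1) := by
  have h : ∀ x : ℝ, (N.choose k : ℝ) * (x ^ k * (2 - x) ^ (N - k))
      = 2 ^ N * (bernsteinPolynomial ℝ N k).eval (x / 2) := by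
    intro x
    have h2 : (2 - x) = 2 * (1 - x / 2) := by ring
    have h3 : x ^ k = 2 ^ k * (x / 2) ^ k := by rw [← mul_pow]; ring_nf
    have h4 : (2 : ℝ) ^ N = 2 ^ k * 2 ^ (N - k) := by rw [← pow_add, Nat.add_sub_cancel' hk]
    rw [h2, mul_pow, h3, h4]
    simp [bernsteinPolynomial]
    ring
  simp only [h]
  rw [intervalIntegral.integral_const_mul,
    intervalIntegral.integral_comp_div (fun x => (bernsteinPolynomial ℝ N k).eval x) two_ne_zero]
  norm_num [integral_bernsteinPolynomial hk]
  ring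

lemma sixteen_pow_le_mul_centralBinom_sq {n : ℕ} (hn : 1 ≤ n) :
    16 ^ n ≤ 4 * n * n.centralBinom ^ 2 := by
  induction n, hn using Nat.le_induction with
  | base => decide
  | succ n hn ih =>
    have h := Nat.succ_mul_centralBinom_succ n
    refine le_of_mul_le_mul_left (a := n + 1) ?_ n.succ_pos
    calc (n + 1) * 16 ^ (n + 1) = 16 * (n + 1) * 16 ^ n := by ring
      _ ≤ 16 * (n + 1) * (4 * n * n.centralBinom ^ 2) := Nat.mul_le_mul_left _ ih
      _ ≤ 4 * (2 * (2 * n + 1) * n.centralBinom) ^ 2 := by nlinarith [sq_nonneg n.centralBinom]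
      _ = (n + 1) * (4 * (n + 1) * (n + 1).centralBinom ^ 2) := by rw [← h]; ring

lemma four_pow_le_two_mul_sqrt_mul_centralBinom {n : ℕ} (hn : 1 ≤ n) :
    (4 : ℝ) ^ n ≤ 2 * √n * n.centralBinom := by
  refine le_of_sq_le_sq ?_ (by positivity)
  have h : ((16 ^ n : ℕ) : ℝ) ≤ (4 * n * n.centralBinom ^ 2 : ℕ) :=
    Nat.cast_le.2 (sixteen_pow_le_mul_centralBinom_sq hn)
  push_cast at h
  rw [mul_pow, mul_pow, Real.sq_sqrt n.cast_nonneg, ← pow_mul, mul_comm n 2, pow_mul]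
  norm_num
  exact h

lemma antitoneOn_pow_mul_pow_mul_exp {n k : ℕ} (hk : k ≤ 2 * n) {c : ℝ} (hc : n * c = k)
    (hc0 : 0 ≤ c) :
    AntitoneOn (fun x : ℝ => x ^ k * (2 - x) ^ (2 * n - k) * Real.exp (n * (x - c) ^ 2))
      (Set.Icc c 1) := by
  set m := 2 * n - k with hm
  have hm' : (m : ℝ) = 2 * n - k := by rw [hm, Nat.cast_sub hk]; push_cast; ring
  have hd : ∀ x : ℝ, HasDerivAt
      (fun x : ℝ => x ^ k * (2 - x) ^ m * Real.exp (n * (x - c) ^ 2))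
      ((k * x ^ (k - 1) * (2 - x) ^ m - x ^ k * (m * (2 - x) ^ (m - 1))) *
        Real.exp (n * (x - c) ^ 2) +
        x ^ k * (2 - x) ^ m * (Real.exp (n * (x - c) ^ 2) * (n * (2 * (x - c))))) x := by
    intro x
    have h1 := hasDerivAt_pow k x
    have h2 := ((hasDerivAt_id x).const_sub 2).pow m
    have h3 := ((((hasDerivAt_id x).sub_const c).pow 2).const_mul (n : ℝ)).exp
    refine ((h1.mul h2).mul h3).congr_deriv ?_
    simp
    ring
  refine antitoneOn_of_deriv_nonpos (convex_Icc c 1)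
    (fun x _ => (hd x).continuousAt.continuousWithinAt)
    (fun x _ => (hd x).differentiableAt.differentiableWithinAt) fun x hx => ?_
  rw [interior_Icc] at hx
  rw [(hd x).deriv]
  have hx0 : 0 < x := hc0.trans_lt hx.1
  have hx2 : 0 < 2 - x := by linarith [hx.2]
  have e1 : (k : ℝ) * x ^ (k - 1) * x = k * x ^ k := by
    rcases k with _ | k
    · simp
    · rw [Nat.add_sub_cancel, pow_succ]; ring
  have e2 : (m : ℝ) * (2 - x) ^ (m - 1) * (2 - x) = m * (2 - x) ^ m := by
    rcases m with _ | m
    · simp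
    · rw [Nat.add_sub_cancel, pow_succ]; ring
  refine nonpos_of_mul_nonpos_left (b := x * (2 - x)) ?_ (by positivity)
  have key : ((k * x ^ (k - 1) * (2 - x) ^ m - x ^ k * (m * (2 - x) ^ (m - 1))) *
        Real.exp (n * (x - c) ^ 2) +
        x ^ k * (2 - x) ^ m * (Real.exp (n * (x - c) ^ 2) * (n * (2 * (x - c))))) * (x * (2 - x))
      = -(2 * n * (x - c) * (1 - x) ^ 2 * (x ^ k * (2 - x) ^ m * Real.exp (n * (x - c) ^ 2))) := by
    have e3 : (k : ℝ) * (2 - x) - m * x = -(2 * n * (x - c)) := by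
      rw [hm', ← hc]; ring
    set E := Real.exp (n * (x - c) ^ 2)
    linear_combination ((2 - x) ^ m * (2 - x) * E) * e1 - (x ^ k * x * E) * e2
      + (x ^ k * (2 - x) ^ m * E) * e3
  rw [key]
  have := sub_pos.2 hx.1
  exact neg_nonpos.2 (by positivity)

lemma choose_mul_pow_mul_pow_le {n k : ℕ} (hn : 1 ≤ n) (hk : k ≤ 2 * n) {c T : ℝ}
    (hc : n * c = k) (hcT : 1 ≤ √n * (T - c)) (hT : T ≤ 1) :
    (2 * n).choose k * T ^ k * (2 - T) ^ (2 * n - k)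
      ≤ 3 * Real.exp (-(n * (T - c) ^ 2)) * n.centralBinom := by
  have hn0 : (0 : ℝ) < n := by exact_mod_cast hn
  have hc0 : 0 ≤ c := by
    have : 0 ≤ n * c := by rw [hc]; positivity
    exact nonneg_of_mul_nonneg_right this hn0
  set s := √(n : ℝ) with hs
  have hs0 : 0 < s := Real.sqrt_pos.2 hn0
  have hs2 : s ^ 2 = n := Real.sq_sqrt hn0.le
  have hrT : c + 1 / s ≤ T := by
    have : 1 / s ≤ T - c := by rw [div_le_iff₀ hs0]; linarith
    linarith
  have hr0 : 0 < 1 / s := by positivity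
  set b : ℝ → ℝ := fun x => (2 * n).choose k * (x ^ k * (2 - x) ^ (2 * n - k)) with hb
  have hbc : Continuous b := by fun_prop
  set K := b T * Real.exp (n * (T - c) ^ 2) with hK
  have hT0 : 0 ≤ T := by linarith
  have hK0 : 0 ≤ K := by
    have : 0 ≤ 2 - T := by linarith
    positivity
  have hlow : ∀ x ∈ Set.Icc c (c + 1 / s), K * (1 - n * (x - c) ^ 2) ≤ b x := by
    intro x hx
    have h1 := antitoneOn_pow_mul_pow_mul_exp hk hc hc0 ⟨hx.1, hx.2.trans (hrT.trans hT)⟩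
      ⟨hx.1.trans (hx.2.trans hrT), hT⟩ (hx.2.trans hrT)
    have h2 : K ≤ b x * Real.exp (n * (x - c) ^ 2) := by
      have := mul_le_mul_of_nonneg_left h1 ((2 * n).choose k).cast_nonneg (α := ℝ)
      simp only [hK, hb]
      linarith
    have h3 := Real.one_sub_le_exp_neg (n * (x - c) ^ 2)
    calc K * (1 - n * (x - c) ^ 2) ≤ K * Real.exp (-(n * (x - c) ^ 2)) := by gcongr
      _ ≤ b x * Real.exp (n * (x - c) ^ 2) * Real.exp (-(n * (x - c) ^ 2)) := by gcongr
      _ = b x := by rw [mul_assoc, ← Real.exp_add]; simp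
  have hint1 : ∫ x in c..c + 1 / s, K * (1 - n * (x - c) ^ 2) = K * (2 / (3 * s)) := by
    rw [intervalIntegral.integral_const_mul,
      intervalIntegral.integral_comp_sub_right (fun x => 1 - (n : ℝ) * x ^ 2),
      intervalIntegral.integral_sub (by simp) (Continuous.intervalIntegrable (by fun_prop) _ _),
      intervalIntegral.integral_const_mul, integral_pow, ← hs2, sub_self, add_sub_cancel_left,
      intervalIntegral.integral_const, smul_eq_mul]
    congr 1
    push_cast
    field_simp
    ring
  have hint2 : ∫ x in c..c + 1 / s, K * (1 - n * (x - c) ^ 2) ≤ ∫ x in c..c + 1 / s, b x :=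
    intervalIntegral.integral_mono_on (by linarith)
      (Continuous.intervalIntegrable (by fun_prop) _ _) (hbc.intervalIntegrable _ _) hlow
  have hint3 : ∫ x in c..c + 1 / s, b x ≤ ∫ x in (0 : ℝ)..2, b x := by
    refine intervalIntegral.integral_mono_interval hc0 (by linarith) (by linarith) ?_
      (hbc.intervalIntegrable _ _)
    refine (ae_restrict_mem measurableSet_Ioc).mono fun x hx => ?_
    have := hx.1.le
    have : 0 ≤ 2 - x := by linarith [hx.2]
    simp only [hb, Pi.zero_apply]
    positivity
  rw [hint1] at hint2
  have hint4 := hint2.trans hint3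
  rw [integral_choose_mul_pow_mul_two_sub_pow hk] at hint4
  have h4 := four_pow_le_two_mul_sqrt_mul_centralBinom hn
  rw [← hs] at h4
  have h5 : (2 : ℝ) ^ (2 * n + 1) / ((2 * n : ℕ) + 1) ≤ 2 / s * n.centralBinom := by
    rw [div_le_iff₀ (by positivity), pow_succ, pow_mul]
    push_cast
    rw [← hs2]
    have h6 : 2 / s * (n.centralBinom : ℝ) * (2 * s ^ 2 + 1)
        = 4 * s * n.centralBinom + 2 / s * n.centralBinom := by field_simp; ring
    have h7 : 0 ≤ 2 / s * (n.centralBinom : ℝ) := by positivity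
    rw [h6]
    norm_num
    linarith
  have h6 := hint4.trans h5
  have h7 : K ≤ 3 * n.centralBinom := by
    have : K * (2 / (3 * s)) * (3 * s / 2) ≤ 2 / s * n.centralBinom * (3 * s / 2) := by gcongr
    field_simp at this
    linarith
  calc (2 * n).choose k * T ^ k * (2 - T) ^ (2 * n - k)
      = K * Real.exp (-(n * (T - c) ^ 2)) := by
        rw [hK, mul_assoc (b T), ← Real.exp_add]; simp [hb, mul_assoc]
    _ ≤ 3 * n.centralBinom * Real.exp (-(n * (T - c) ^ 2)) := by gcongr
    _ = _ := by ring

section Quantile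

open ProbabilityTheory

/-- The quantile transform of a distribution on `ℝ`. -/
lemma exists_quantile (p : Measure ℝ) [IsProbabilityMeasure p] :
    ∃ Q : ℝ → ℝ, MeasurePreserving Q (volume.restrict (Set.Ioc 0 1)) p ∧
      ∀ u ∈ Set.Ioo (0 : ℝ) 1, ∀ a, Q u ≤ a ↔ u ≤ p.real (Set.Iic a) := by
  simp only [← cdf_eq_real]
  let Q : ℝ → ℝ := fun u => if u ∈ Set.Ioo (0 : ℝ) 1 then sInf {a | u ≤ cdf p a} else 0
  have hQ : ∀ u ∈ Set.Ioo (0 : ℝ) 1, ∀ a, Q u ≤ a ↔ u ≤ cdf p a := by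
    intro u hu a
    simp only [Q, if_pos hu]
    obtain ⟨b, hb⟩ := ((tendsto_cdf_atTop p).eventually_const_lt hu.2).exists
    obtain ⟨c, hc⟩ := ((tendsto_cdf_atBot p).eventually_lt_const hu.1).exists
    have hbdd : BddBelow {a | u ≤ cdf p a} := by
      refine ⟨c, fun x hx => ?_⟩
      by_contra! h
      exact absurd ((monotone_cdf p h.le).trans_lt hc) (not_lt.2 hx)
    refine ⟨fun h => ?_, fun h => csInf_le hbdd h⟩
    refine ge_of_tendsto (((cdf p).right_continuous a).mono_left
      (nhdsWithin_mono a Set.Ioi_subset_Ici_self)) ?_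
    filter_upwards [self_mem_nhdsWithin] with y hy
    obtain ⟨z, hz, hzy⟩ := (csInf_lt_iff hbdd ⟨b, hb.le⟩).1 (h.trans_lt hy)
    exact le_trans hz (monotone_cdf p hzy.le)
  have hmeas : Measurable Q := by
    refine measurable_of_Iic fun a => ?_
    have : Q ⁻¹' Set.Iic a =
        (Set.Ioo 0 1 ∩ Set.Iic (cdf p a)) ∪ ((Set.Ioo 0 1)ᶜ ∩ {_u | 0 ≤ a}) := by
      ext u
      by_cases hu : u ∈ Set.Ioo (0 : ℝ) 1
      · simp only [Set.mem_preimage, Set.mem_Iic, hQ u hu a, Set.mem_union, Set.mem_inter_iff, hu,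
          Set.mem_compl_iff]
        simp
      · simp only [Set.mem_preimage, Set.mem_Iic, Set.mem_union, Set.mem_inter_iff, hu,
          Set.mem_compl_iff, Q]
        simp
    rw [this]
    exact (measurableSet_Ioo.inter measurableSet_Iic).union
      (measurableSet_Ioo.compl.inter (MeasurableSet.const _))
  refine ⟨Q, ⟨hmeas, Measure.ext_of_Iic _ _ fun a => ?_⟩, hQ⟩
  rw [Measure.map_apply hmeas measurableSet_Iic, ← restrict_Ioo_eq_restrict_Ioc,
    Measure.restrict_apply (hmeas measurableSet_Iic), ← ofReal_cdf p a]
  have h1 : Q ⁻¹' Set.Iic a ∩ Set.Ioo 0 1 = Set.Ioo 0 1 ∩ Set.Iic (cdf p a) := by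
    ext u
    simp only [Set.mem_inter_iff, Set.mem_preimage, Set.mem_Iic]
    exact ⟨fun h => ⟨h.2, (hQ u h.2 a).1 h.1⟩, fun h => ⟨(hQ u h.1 a).2 h.2, h.1⟩⟩
  have h2 : (Set.Ioo 0 1 ∩ Set.Iic (cdf p a) : Set ℝ) =ᵐ[volume] Set.Ioc 0 (cdf p a) := by
    have h3 : (Set.Ioc 0 (cdf p a) : Set ℝ) = Set.Ioc 0 1 ∩ Set.Iic (cdf p a) := by
      rw [Set.Ioc_inter_Iic, min_eq_right (cdf_le_one p a)]
    rw [h3]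
    exact Ioo_ae_eq_Ioc.inter (ae_eq_refl _)
  rw [h1, measure_congr h2, Real.volume_Ioc, sub_zero]

/-- Rotating the unit interval preserves the uniform distribution. -/
lemma measurePreserving_rotate {d : ℝ} (hd0 : 0 ≤ d) (hd1 : d ≤ 1) :
    MeasurePreserving (fun w : ℝ => if w ≤ 1 - d then w + d else w - (1 - d))
      (volume.restrict (Set.Ioc 0 1)) (volume.restrict (Set.Ioc 0 1)) := by
  have hmeas : Measurable fun w : ℝ => if w ≤ 1 - d then w + d else w - (1 - d) :=
    Measurable.ite measurableSet_Iic (by fun_prop) (by fun_prop)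
  have h1 : MeasurePreserving (fun w : ℝ => w + d) (volume.restrict (Set.Ioc 0 (1 - d)))
      (volume.restrict (Set.Ioc d 1)) := by
    have := (measurePreserving_add_right volume d).restrict_preimage
      (measurableSet_Ioc (a := d) (b := 1))
    simpa using this
  have h2 : MeasurePreserving (fun w : ℝ => w - (1 - d)) (volume.restrict (Set.Ioc (1 - d) 1))
      (volume.restrict (Set.Ioc 0 d)) := by
    have := (measurePreserving_sub_right volume (1 - d)).restrict_preimage
      (measurableSet_Ioc (a := 0) (b := d))
    simpa using this
  refine ⟨hmeas, ?_⟩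
  have hsplit : ∀ c : ℝ, 0 ≤ c → c ≤ 1 → (volume.restrict (Set.Ioc 0 1) : Measure ℝ)
      = volume.restrict (Set.Ioc 0 c) + volume.restrict (Set.Ioc c 1) := by
    intro c h0 h1
    rw [← Set.Ioc_union_Ioc_eq_Ioc h0 h1, Measure.restrict_union
      (Set.Ioc_disjoint_Ioc_of_le le_rfl) measurableSet_Ioc]
  have e1 : Measure.map (fun w : ℝ => if w ≤ 1 - d then w + d else w - (1 - d))
      (volume.restrict (Set.Ioc 0 (1 - d))) = volume.restrict (Set.Ioc d 1) := by
    rw [← h1.map_eq]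
    refine Measure.map_congr ?_
    filter_upwards [ae_restrict_mem measurableSet_Ioc] with w hw
    rw [if_pos hw.2]
  have e2 : Measure.map (fun w : ℝ => if w ≤ 1 - d then w + d else w - (1 - d))
      (volume.restrict (Set.Ioc (1 - d) 1)) = volume.restrict (Set.Ioc 0 d) := by
    rw [← h2.map_eq]
    refine Measure.map_congr ?_
    filter_upwards [ae_restrict_mem measurableSet_Ioc] with w hw
    rw [if_neg (not_le.2 hw.1)]
  conv_lhs => rw [hsplit (1 - d) (by linarith) (by linarith)]
  rw [Measure.map_add _ _ hmeas, e1, e2, add_comm, ← hsplit d hd0 hd1]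

/-- If the c.d.f. of `p` exceeds that of `q` by at most `d`, both distributions can be generated
from uniform variables so that, on `(0, 1 - d]`, being above `a` for `p` and at most `a` for `q`
are governed by a common threshold. -/
lemma exists_uniform_representation (p q : Measure ℝ) [IsProbabilityMeasure p]
    [IsProbabilityMeasure q] {d : ℝ} (hd0 : 0 ≤ d) (hd1 : d ≤ 1)
    (h : ∀ a, p.real (Set.Iic a) ≤ q.real (Set.Iic a) + d) :
    ∃ f g : ℝ → ℝ, MeasurePreserving f (volume.restrict (Set.Ioc 0 1)) p ∧
      MeasurePreserving g (volume.restrict (Set.Ioc 0 1)) q ∧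
      ∀ᵐ w ∂(volume.restrict (Set.Ioc (0 : ℝ) 1)), ∀ a,
        (w ≤ min (q.real (Set.Iic a)) (1 - d) → g w ≤ a) ∧
        (min (q.real (Set.Iic a)) (1 - d) < w → w ≤ 1 - d → a < f w) := by
  obtain ⟨Qp, hQp, hQp'⟩ := exists_quantile p
  obtain ⟨Qq, hQq, hQq'⟩ := exists_quantile q
  refine ⟨_, Qq, hQp.comp (measurePreserving_rotate hd0 hd1), hQq, ?_⟩
  rw [← restrict_Ioo_eq_restrict_Ioc]
  filter_upwards [ae_restrict_mem measurableSet_Ioo,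
    ae_restrict_of_ae (Measure.ae_ne volume (1 - d))] with w hw hne a
  refine ⟨fun h1 => (hQq' w hw a).2 (h1.trans (min_le_left _ _)), fun h1 h2 => ?_⟩
  have h3 : q.real (Set.Iic a) < w := by
    rcases min_lt_iff.1 h1 with h3 | h3
    · exact h3
    · exact absurd h2 (not_le.2 h3)
  have h4 := lt_of_le_of_ne h2 hne
  rw [Function.comp_apply, if_pos h2, ← not_le, hQp' (w + d) ⟨by linarith [hw.1], by linarith⟩ a,
    not_le]
  linarith [h a]

end Quantile

lemma mem_splitEvent_of_splitCount_le {ι : Type*} [Fintype ι] {T t : ℝ} (ht : t ≤ T) {k : ℕ}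
    {A : Finset ι} {w : ι → ℝ} (hk : k < (A.filter fun i => w i ≤ T).card)
    (h : splitCount T A w t ≤ k) : w ∈ splitEvent T k A := by
  refine ⟨hk, ?_⟩
  have hne : (Finset.univ.filter fun i => w i ≤ t).Nonempty := by
    by_contra hemp
    have hlt : ∀ i, t < w i := by
      simpa [Finset.not_nonempty_iff_eq_empty, Finset.filter_eq_empty_iff] using hemp
    have h1 : (A.filter fun i => w i ≤ T).card ≤ splitCount T A w t := by
      refine le_trans (Finset.card_le_card fun i hi => ?_) (Nat.le_add_right _ _)
      simp only [Finset.mem_filter] at hi ⊢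
      exact ⟨hi.1, hlt i, hi.2⟩
    omega
  obtain ⟨j, hj, hmax⟩ := Finset.exists_max_image _ w hne
  simp only [Finset.mem_filter, Finset.mem_univ, true_and] at hj hmax
  have hiff : ∀ i, w i ≤ w j ↔ w i ≤ t := fun i => ⟨fun hi => hi.trans hj, hmax i⟩
  refine ⟨j, hj.trans ht, ?_⟩
  convert h using 1
  simp only [splitCount, ← not_le, hiff]

/-- Comparison of two independent samples with a common uniform sample. -/
lemma prod_measure_exists_le_measure_splitEvent (n k : ℕ) (p q : Measure ℝ)
    [IsProbabilityMeasure p] [IsProbabilityMeasure q] {d : ℝ} (hd0 : 0 ≤ d) (hd1 : d ≤ 1)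
    (h : ∀ a, p.real (Set.Iic a) ≤ q.real (Set.Iic a) + d) {A : Finset (Fin n ⊕ Fin n)}
    (hA : A = Finset.univ.map Function.Embedding.inl) :
    ((Measure.pi fun _ : Fin n => p).prod (Measure.pi fun _ : Fin n => q))
        {z | ∃ i, (Finset.univ.filter fun j => z.1 i < z.1 j).card +
          (Finset.univ.filter fun j => z.2 j ≤ z.1 i).card ≤ k}
      ≤ (Measure.pi fun _ : Fin n ⊕ Fin n => volume.restrict (Set.Ioc (0 : ℝ) 1))
        ({w | (A.filter fun i => w i ≤ 1 - d).card ≤ k} ∪ splitEvent (1 - d) k A) := by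
  obtain ⟨f, g, hf, hg, hfg⟩ := exists_uniform_representation p q hd0 hd1 h
  set ν : Measure ℝ := volume.restrict (Set.Ioc (0 : ℝ) 1)
  have hΦ := ((measurePreserving_pi (fun _ : Fin n => ν) (fun _ => p) fun _ => hf).prod
    (measurePreserving_pi (fun _ : Fin n => ν) (fun _ => q) fun _ => hg)).comp
    (measurePreserving_sumPiEquivProdPi fun _ : Fin n ⊕ Fin n => ν)
  have hmeas : MeasurableSet {z : (Fin n → ℝ) × (Fin n → ℝ) |
      ∃ i, (Finset.univ.filter fun j => z.1 i < z.1 j).card +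
          (Finset.univ.filter fun j => z.2 j ≤ z.1 i).card ≤ k} := by
    simp only [Finset.card_filter, Set.ofPred_exists]
    refine MeasurableSet.iUnion fun i => measurableSet_le (Measurable.add
      (Finset.measurable_sum _ fun j _ => Measurable.ite
        (measurableSet_lt (by fun_prop) (by fun_prop)) measurable_const measurable_const)
      (Finset.measurable_sum _ fun j _ => Measurable.ite
        (measurableSet_le (by fun_prop) (by fun_prop)) measurable_const measurable_const))
      measurable_const
  rw [← hΦ.measure_preimage hmeas.nullMeasurableSet]
  refine measure_mono_ae ?_
  have hae : ∀ᵐ w ∂(Measure.pi fun _ : Fin n ⊕ Fin n => ν), ∀ i, ∀ a,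
        (w i ≤ min (q.real (Set.Iic a)) (1 - d) → g (w i) ≤ a) ∧
        (min (q.real (Set.Iic a)) (1 - d) < w i → w i ≤ 1 - d → a < f (w i)) :=
    Filter.eventually_all.2 fun i => (Measure.tendsto_eval_ae_ae (μ := fun _ => ν)).eventually hfg
  filter_upwards [hae] with w hw hmem
  obtain ⟨i, hi⟩ := hmem
  simp only [Function.comp_apply, Prod.map] at hi
  by_cases hk : (A.filter fun i => w i ≤ 1 - d).card ≤ k
  · exact Or.inl hk
  refine Or.inr (mem_splitEvent_of_splitCount_le
    (min_le_right (q.real (Set.Iic (f (w (.inl i))))) (1 - d)) (not_le.1 hk)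
    (le_trans (add_le_add ?_ ?_) hi))
  · rw [hA, Finset.filter_map, Finset.card_map]
    refine Finset.card_le_card fun j hj => ?_
    simp only [Finset.mem_filter, Finset.mem_univ, true_and, Function.comp_apply,
      Function.Embedding.inl_apply] at hj ⊢
    exact (hw (.inl j) _).2 hj.1 hj.2
  · refine le_of_le_of_eq ?_ (Finset.card_map (Function.Embedding.inr : Fin n ↪ Fin n ⊕ Fin n))
    refine Finset.card_le_card fun j hj => ?_
    simp only [Finset.mem_filter, Finset.mem_compl, hA] at hj
    rcases j with j | j
    · simp at hj
    · exact Finset.mem_map_of_mem _ (Finset.mem_filter.2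
        ⟨Finset.mem_univ _, (hw (.inr j) _).1 hj.2⟩)

lemma exists_lt_empCDF_sub_at_sample {n : ℕ} {x y : Fin n → ℝ} {a c : ℝ} (hc : 0 ≤ c)
    (h : c < empCDF x a - empCDF y a) : ∃ i, c < empCDF x (x i) - empCDF y (x i) := by
  have hne : (Finset.univ.filter fun i => x i ≤ a).Nonempty := by
    by_contra hemp
    have h1 : empCDF x a = 0 := by simp [empCDF, Finset.not_nonempty_iff_eq_empty.1 hemp]
    have h2 : 0 ≤ empCDF y a := by unfold empCDF; positivity
    linarith
  obtain ⟨i, hi, hmax⟩ := Finset.exists_max_image _ x hne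
  simp only [Finset.mem_filter, Finset.mem_univ, true_and] at hi hmax
  refine ⟨i, h.trans_le (sub_le_sub ?_ ?_)⟩
  · unfold empCDF
    refine div_le_div_of_nonneg_right (Nat.cast_le.2 (Finset.card_le_card fun j hj => ?_))
      n.cast_nonneg
    simp only [Finset.mem_filter, Finset.mem_univ, true_and] at hj ⊢
    exact hmax j hj
  · unfold empCDF
    gcongr

lemma card_lt_add_card_le_of_lt_empCDF_sub {n : ℕ} {x y : Fin n → ℝ} {a c : ℝ}
    (hn : 1 ≤ n) (h : c < empCDF x a - empCDF y a) :
    (((Finset.univ.filter fun j => a < x j).card + (Finset.univ.filter fun j => y j ≤ a).card : ℕ)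
      : ℝ) ≤ n * (1 - c) := by
  have hn0 : (0 : ℝ) < n := by exact_mod_cast hn
  have h1 : ((Finset.univ.filter fun j => x j ≤ a).card : ℝ)
      + (Finset.univ.filter fun j => a < x j).card = n := by
    have := Finset.card_filter_add_card_filter_not (s := Finset.univ) fun j => x j ≤ a
    simp only [not_le, Finset.card_univ, Fintype.card_fin] at this
    exact_mod_cast this
  rw [empCDF, empCDF, ← sub_div, lt_div_iff₀ hn0] at h
  push_cast
  linarith

/-- One-sided deviation bound for the empirical c.d.f.'s of two independent samples. -/
lemma prod_measure_lt_empCDF_sub_le (n : ℕ) (p q : Measure ℝ)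
    [IsProbabilityMeasure p] [IsProbabilityMeasure q] {d c : ℝ} (hd : 0 ≤ d) (hdc : d < c)
    (h : ∀ a, p.real (Set.Iic a) ≤ q.real (Set.Iic a) + d)
    (hexp : 4 * Real.exp (-((n : ℝ) * (c - d) ^ 2) / 2) < 1) :
    ((Measure.pi fun _ : Fin n => p).prod (Measure.pi fun _ : Fin n => q))
        {z | ∃ i, c < empCDF z.1 (z.1 i) - empCDF z.2 (z.1 i)}
      ≤ ENNReal.ofReal (2 * Real.exp (-((n : ℝ) * (c - d) ^ 2) / 2)) := by
  have hδ : 0 < c - d := sub_pos.2 hdc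
  have hnδ : 1 ≤ (n : ℝ) * (c - d) ^ 2 := by
    have := Real.add_one_le_exp (-((n : ℝ) * (c - d) ^ 2) / 2)
    linarith
  have hn : 1 ≤ n := by
    rcases Nat.eq_zero_or_pos n with rfl | hn
    · norm_num at hnδ
    · exact hn
  have hn0 : (0 : ℝ) < n := by exact_mod_cast hn
  by_cases hc1 : 1 < c
  · refine (measure_mono_null (t := ∅) (fun z hz => ?_) measure_empty).trans_le zero_le
    exfalso
    obtain ⟨i, hi⟩ := hz
    have h1 := card_lt_add_card_le_of_lt_empCDF_sub hn hi
    have h2 := (Nat.cast_nonneg (α := ℝ) _).trans h1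
    nlinarith
  rw [not_lt] at hc1
  set k := ⌊n * (1 - c)⌋₊ with hk
  have hk' : (k : ℝ) ≤ n * (1 - c) := Nat.floor_le (mul_nonneg hn0.le (by linarith))
  set A : Finset (Fin n ⊕ Fin n) := Finset.univ.map Function.Embedding.inl with hA
  have hAn : A.card = n := by simp [hA]
  have hN : Fintype.card (Fin n ⊕ Fin n) = 2 * n := by simp [two_mul]
  set ν : Measure ℝ := volume.restrict (Set.Ioc (0 : ℝ) 1) with hν
  have : IsProbabilityMeasure ν := ⟨by simp [hν]⟩
  have hνT : ν.real (Set.Iic (1 - d)) = 1 - d := by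
    rw [hν, measureReal_restrict_apply measurableSet_Iic, Set.inter_comm, Set.Ioc_inter_Iic,
      min_eq_right (by linarith), Real.volume_real_Ioc_of_le (by linarith), sub_zero]
  have hk2 : k ≤ 2 * n := by
    have : (k : ℝ) ≤ n := hk'.trans (by nlinarith)
    have : k ≤ n := by exact_mod_cast this
    omega
  set E := Real.exp (-((n : ℝ) * (c - d) ^ 2) / 2) with hE
  have hbound1 : (Measure.pi fun _ : Fin n ⊕ Fin n => ν).real
      {w | (A.filter fun i => w i ≤ 1 - d).card ≤ k} ≤ E := by
    have := measureReal_card_filter_le ν (1 - d) k A hδ.le (by rw [hνT, hAn]; linarith)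
    rwa [hAn] at this
  have hbound2 : (Measure.pi fun _ : Fin n ⊕ Fin n => ν).real (splitEvent (1 - d) k A) ≤ E := by
    have h1 := choose_mul_measureReal_splitEvent_le ν (1 - d) (k := k) (hN ▸ hk2) A
    rw [hνT, hAn, hN, ← Nat.centralBinom_eq_two_mul_choose] at h1
    have hgap : c - d ≤ 1 - d - k / n := by
      have : (k : ℝ) / n ≤ 1 - c := by rwa [div_le_iff₀' hn0]
      linarith
    have h2 := choose_mul_pow_mul_pow_le hn hk2 (mul_div_cancel₀ (k : ℝ) hn0.ne')
      (T := 1 - d) ?_ (by linarith)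
    · have h3 : (Measure.pi fun _ : Fin n ⊕ Fin n => ν).real (splitEvent (1 - d) k A)
          ≤ 3 * Real.exp (-(n * (1 - d - k / n) ^ 2)) := by
        have h4 : (0 : ℝ) < n.centralBinom := by exact_mod_cast n.centralBinom_pos
        refine le_of_mul_le_mul_left ?_ h4
        linarith
      have h5 : Real.exp (-(n * (1 - d - k / n) ^ 2)) ≤ E * E := by
        rw [hE, ← Real.exp_add, Real.exp_le_exp]
        have : (n : ℝ) * (c - d) ^ 2 ≤ n * (1 - d - k / n) ^ 2 := by gcongr
        linarith
      have h6 : 0 < E := Real.exp_pos _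
      nlinarith
    · refine le_trans (le_of_sq_le_sq ?_ (by positivity)) (mul_le_mul_of_nonneg_left hgap
        (Real.sqrt_nonneg _))
      rw [mul_pow, Real.sq_sqrt hn0.le, one_pow]
      exact hnδ
  calc ((Measure.pi fun _ : Fin n => p).prod (Measure.pi fun _ : Fin n => q))
        {z | ∃ i, c < empCDF z.1 (z.1 i) - empCDF z.2 (z.1 i)}
      ≤ ((Measure.pi fun _ : Fin n => p).prod (Measure.pi fun _ : Fin n => q))
        {z | ∃ i, (Finset.univ.filter fun j => z.1 i < z.1 j).card +
          (Finset.univ.filter fun j => z.2 j ≤ z.1 i).card ≤ k} := by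
        refine measure_mono fun z hz => ?_
        obtain ⟨i, hi⟩ := hz
        exact ⟨i, Nat.le_floor (card_lt_add_card_le_of_lt_empCDF_sub hn hi)⟩
    _ ≤ _ := prod_measure_exists_le_measure_splitEvent n k p q hd (by linarith) h hA
    _ = ENNReal.ofReal ((Measure.pi fun _ : Fin n ⊕ Fin n => ν).real
        ({w | (A.filter fun i => w i ≤ 1 - d).card ≤ k} ∪ splitEvent (1 - d) k A)) := by
        rw [ofReal_measureReal]
    _ ≤ ENNReal.ofReal (2 * E) := by
        refine ENNReal.ofReal_le_ofReal ((measureReal_union_le _ _).trans ?_)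
        linarith

lemma abs_cdfOf_sub_le_one (p q : Measure ℝ) [IsProbabilityMeasure p] [IsProbabilityMeasure q]
    (a : ℝ) : |cdfOf p a - cdfOf q a| ≤ 1 := by
  have h : ∀ (r : Measure ℝ) [IsProbabilityMeasure r], 0 ≤ cdfOf r a ∧ cdfOf r a ≤ 1 :=
    fun r _ => ⟨measureReal_nonneg, measureReal_le_one⟩
  rw [abs_le]
  constructor <;> linarith [(h p).1, (h p).2, (h q).1, (h q).2]

lemma abs_cdfOf_sub_le_ksDist (p q : Measure ℝ) [IsProbabilityMeasure p] [IsProbabilityMeasure q]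
    (a : ℝ) : |cdfOf p a - cdfOf q a| ≤ ksDist p q :=
  le_ciSup (f := fun a => |cdfOf p a - cdfOf q a|)
    ⟨1, Set.forall_mem_range.2 (abs_cdfOf_sub_le_one p q)⟩ a

/-- Lemma: intra-cluster concentration of the KS distance.
If `P` is a set of probability distributions on ℝ of KS-diameter `d_L`, and `x₁, x₂` are
independent sequences of `n` i.i.d. samples from `p₁ ∈ P` and `p₂ ∈ P` respectively, then
for every `d₀ > d_L`, `P(d_KS(x₁,x₂) > d₀) ≤ 4 exp(-n (d₀ - d_L)^2 / 2)`. -/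
theorem stmt0 (P : Set (Measure ℝ)) (hP : ∀ p ∈ P, IsProbabilityMeasure p)
    (dL : ℝ) (hdiam : sSup {r : ℝ | ∃ p ∈ P, ∃ q ∈ P, r = ksDist p q} = dL)
    (n : ℕ) (p₁ p₂ : Measure ℝ) (hp₁ : p₁ ∈ P) (hp₂ : p₂ ∈ P)
    (d₀ : ℝ) (hd₀ : dL < d₀) :
    ((Measure.pi fun _ : Fin n => p₁).prod (Measure.pi fun _ : Fin n => p₂))
        {ω : (Fin n → ℝ) × (Fin n → ℝ) | ksDistSeq ω.1 ω.2 > d₀}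
      ≤ ENNReal.ofReal (4 * Real.exp (-((n : ℝ) * (d₀ - dL) ^ 2) / 2)) := by
 

  have := hP p₁ hp₁
  have := hP p₂ hp₂
  by_cases hexp : 1 ≤ 4 * Real.exp (-((n : ℝ) * (d₀ - dL) ^ 2) / 2)
  · exact prob_le_one.trans (ENNReal.one_le_ofReal.2 hexp)
  rw [not_le] at hexp
  have hle : ∀ p ∈ P, ∀ q ∈ P, ∀ a, |cdfOf p a - cdfOf q a| ≤ dL := by
    intro p hp q hq a
    have := hP p hp
    have := hP q hq
    rw [← hdiam]
    refine (abs_cdfOf_sub_le_ksDist p q a).trans (le_csSup ⟨1, ?_⟩ ⟨p, hp, q, hq, rfl⟩)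
    rintro r ⟨p', hp', q', hq', rfl⟩
    have := hP p' hp'
    have := hP q' hq'
    exact ciSup_le (abs_cdfOf_sub_le_one p' q')
  have hdL : 0 ≤ dL := (abs_nonneg _).trans (hle p₁ hp₁ p₁ hp₁ 0)
  have h1 := prod_measure_lt_empCDF_sub_le n p₁ p₂ hdL hd₀
    (fun a => sub_le_iff_le_add'.1 ((le_abs_self _).trans (hle p₁ hp₁ p₂ hp₂ a))) hexp
  have h2 := prod_measure_lt_empCDF_sub_le n p₂ p₁ hdL hd₀
    (fun a => sub_le_iff_le_add'.1 ((le_abs_self _).trans (hle p₂ hp₂ p₁ hp₁ a))) hexp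
  rw [← Measure.prod_swap] at h2
  have h3 := (Measure.le_map_apply measurable_swap.aemeasurable _).trans h2
  calc _ ≤ _ := measure_mono fun z hz => ?_
    _ ≤ _ := measure_union_le _ _
    _ ≤ _ := add_le_add h1 h3
    _ = _ := by rw [← ENNReal.ofReal_add (by positivity) (by positivity)]; ring_nf
  obtain ⟨a, ha⟩ := exists_lt_of_lt_ciSup (show d₀ < ksDistSeq z.1 z.2 from hz)
  rcases lt_abs.1 ha with ha | ha
  · exact Or.inl (exists_lt_empCDF_sub_at_sample (hdL.trans hd₀.le) ha)
  · rw [neg_sub] at ha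
    exact Or.inr (exists_lt_empCDF_sub_at_sample (hdL.trans hd₀.le) ha)
end

section
/- Let P₁ and P₂ be sets of probability distributions on ℝ with inf_{p∈P₁, p'∈P₂} d_KS(p,p') = d_H > 0. Let x₁ and x₂ be independent sequences of n i.i.d. samples drawn from p₁ ∈ P₁ and p₂ ∈ P₂ respectively. Then for every d₀ with 0 < d₀ < d_H, P(d_KS(x₁,x₂) ≤ d₀) ≤ 4·exp(−n(d_H − d₀)²/2). -/
open MeasureTheory
open scoped Classical

open ProbabilityTheory

lemma empCDF_nonneg {n : ℕ} (x : Fin n → ℝ) (a : ℝ) : 0 ≤ empCDF x a := by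
  unfold empCDF; positivity

lemma empCDF_le_one {n : ℕ} (x : Fin n → ℝ) (a : ℝ) : empCDF x a ≤ 1 := by
  unfold empCDF
  refine div_le_one_of_le₀ ?_ n.cast_nonneg
  exact_mod_cast (Finset.card_filter_le _ _).trans (by simp)

lemma abs_empCDF_sub_le_ksDistSeq {n : ℕ} (x y : Fin n → ℝ) (a : ℝ) :
    |empCDF x a - empCDF y a| ≤ ksDistSeq x y := by
  refine le_ciSup (f := fun a => |empCDF x a - empCDF y a|) ⟨1, ?_⟩ a
  rintro _ ⟨b, rfl⟩
  exact abs_sub_le_of_nonneg_of_le (empCDF_nonneg x b) (empCDF_le_one x b)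
    (empCDF_nonneg y b) (empCDF_le_one y b)

lemma ksDist_nonneg (p q : Measure ℝ) : 0 ≤ ksDist p q :=
  Real.iSup_nonneg fun _ => abs_nonneg _

lemma sum_indicator_sub_cdfOf {n : ℕ} (p : Measure ℝ) (a : ℝ) (x : Fin n → ℝ) :
    ∑ i, ((Set.Iic a).indicator 1 (x i) - cdfOf p a) = n * (empCDF x a - cdfOf p a) := by
  have hsum : ∑ i, (Set.Iic a).indicator (1 : ℝ → ℝ) (x i) = n * empCDF x a := by
    rcases eq_or_ne n 0 with rfl | hn
    · simp
    · rw [empCDF, mul_div_cancel₀ _ (Nat.cast_ne_zero.mpr hn)]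
      simp [Set.indicator_apply]
  rw [Finset.sum_sub_distrib, hsum]
  simp [mul_sub]

/-- The number of samples times the deviation of the empirical c.d.f. at a point from the true
c.d.f. is sub-Gaussian. -/
lemma hasSubgaussianMGF_empCDF (n : ℕ) (p : Measure ℝ) [IsProbabilityMeasure p] (a : ℝ) :
    HasSubgaussianMGF (fun x : Fin n → ℝ => n * (empCDF x a - cdfOf p a)) (n * (1 / 2) ^ 2)
      (Measure.pi fun _ : Fin n => p) := by
  have hm : Measurable ((Set.Iic a).indicator (1 : ℝ → ℝ)) :=
    measurable_one.indicator measurableSet_Iic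
  have hone : HasSubgaussianMGF (fun y => (Set.Iic a).indicator (1 : ℝ → ℝ) y - cdfOf p a)
      ((1 / 2) ^ 2) p := by
    have h := hasSubgaussianMGF_of_mem_Icc (μ := p) (a := 0) (b := 1) hm.aemeasurable
      (ae_of_all _ fun y => by by_cases hy : y ∈ Set.Iic a <;> simp [hy])
    rw [integral_indicator_one measurableSet_Iic] at h
    simpa [cdfOf, Measure.real] using h
  have hindep : iIndepFun (fun (i : Fin n) (x : Fin n → ℝ) =>
      (Set.Iic a).indicator (1 : ℝ → ℝ) (x i) - cdfOf p a) (Measure.pi fun _ => p) :=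
    iIndepFun_pi (X := fun _ y => (Set.Iic a).indicator (1 : ℝ → ℝ) y - cdfOf p a)
      fun _ => (hm.sub_const _).aemeasurable
  have h := HasSubgaussianMGF.sum_of_iIndepFun hindep (c := fun _ => (1 / 2) ^ 2)
    (s := Finset.univ) fun i _ => by
      refine HasSubgaussianMGF.of_map (Y := fun x : Fin n → ℝ => x i)
        (X := fun y => (Set.Iic a).indicator (1 : ℝ → ℝ) y - cdfOf p a)
        (measurable_pi_apply i).aemeasurable ?_
      rwa [(measurePreserving_eval (fun _ : Fin n => p) i).map_eq]
  simpa only [sum_indicator_sub_cdfOf, Finset.sum_const, Finset.card_univ, Fintype.card_fin,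
    nsmul_eq_mul] using h

lemma measurable_empCDF (n : ℕ) (a : ℝ) : Measurable fun x : Fin n → ℝ => empCDF x a := by
  have heq : (fun x : Fin n → ℝ => empCDF x a) =
      fun x => (∑ i, (Set.Iic a).indicator (1 : ℝ → ℝ) (x i)) / n := by
    ext x
    simp [empCDF, Set.indicator_apply]
  rw [heq]
  exact (Finset.measurable_sum _ fun i _ =>
    (measurable_one.indicator measurableSet_Iic).comp (measurable_pi_apply i)).div_const _

/-- The number of samples times the deviation of the difference of two independent empirical
c.d.f.'s at a point from its mean is sub-Gaussian. -/
lemma hasSubgaussianMGF_empCDF_sub (n : ℕ) (p q : Measure ℝ) [IsProbabilityMeasure p]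
    [IsProbabilityMeasure q] (a : ℝ) :
    HasSubgaussianMGF (fun ω : (Fin n → ℝ) × (Fin n → ℝ) =>
        n * (empCDF ω.1 a - cdfOf p a) - n * (empCDF ω.2 a - cdfOf q a)) (n / 2)
      ((Measure.pi fun _ : Fin n => p).prod (Measure.pi fun _ : Fin n => q)) := by
  have hdev (r : Measure ℝ) : Measurable fun x : Fin n → ℝ => n * (empCDF x a - cdfOf r a) :=
    ((measurable_empCDF n a).sub_const _).const_mul _
  have h₁ : HasSubgaussianMGF (fun ω : (Fin n → ℝ) × (Fin n → ℝ) =>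
      n * (empCDF ω.1 a - cdfOf p a)) (n * (1 / 2) ^ 2)
      ((Measure.pi fun _ : Fin n => p).prod (Measure.pi fun _ : Fin n => q)) := by
    refine HasSubgaussianMGF.of_map (X := fun x : Fin n → ℝ => n * (empCDF x a - cdfOf p a))
      measurable_fst.aemeasurable ?_
    rw [measurePreserving_fst.map_eq]
    exact hasSubgaussianMGF_empCDF n p a
  have h₂ : HasSubgaussianMGF (fun ω : (Fin n → ℝ) × (Fin n → ℝ) =>
      n * (empCDF ω.2 a - cdfOf q a)) (n * (1 / 2) ^ 2)
      ((Measure.pi fun _ : Fin n => p).prod (Measure.pi fun _ : Fin n => q)) := by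
    refine HasSubgaussianMGF.of_map (X := fun x : Fin n → ℝ => n * (empCDF x a - cdfOf q a))
      measurable_snd.aemeasurable ?_
    rw [measurePreserving_snd.map_eq]
    exact hasSubgaussianMGF_empCDF n q a
  have h := h₁.sub_of_indepFun h₂ (indepFun_prod (hdev p) (hdev q))
  have hc : (n * (1 / 2) ^ 2 + n * (1 / 2) ^ 2 : NNReal) = n / 2 := by
    ext; push_cast; ring
  rwa [hc] at h

/-- A lower tail bound for the empirical KS distance when the c.d.f.'s differ by at least `d₀ + t`
at some point. -/
lemma measureReal_ksDistSeq_le (n : ℕ) (p q : Measure ℝ) [IsProbabilityMeasure p]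
    [IsProbabilityMeasure q] {a d₀ t : ℝ} (ht : 0 ≤ t) (ha : d₀ + t ≤ |cdfOf p a - cdfOf q a|) :
    ((Measure.pi fun _ : Fin n => p).prod (Measure.pi fun _ : Fin n => q)).real
      {ω | ksDistSeq ω.1 ω.2 ≤ d₀} ≤ Real.exp (-(n * t ^ 2)) := by
  have hG := hasSubgaussianMGF_empCDF_sub n p q a
  have hexp : -(n * t) ^ 2 / (2 * ((n / 2 : NNReal) : ℝ)) = -(n * t ^ 2) := by
    rcases eq_or_ne n 0 with rfl | hn
    · simp
    · have : (n : ℝ) ≠ 0 := Nat.cast_ne_zero.mpr hn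
      push_cast
      field_simp
  rw [← hexp]
  rcases le_abs.mp ha with ha | ha
  · refine le_trans (measureReal_mono fun ω hω => ?_) (hG.neg.measure_ge_le (by positivity))
    have h := (abs_le.mp ((abs_empCDF_sub_le_ksDistSeq ω.1 ω.2 a).trans hω)).2
    simp only [Set.mem_ofPred_eq, Pi.neg_apply]
    nlinarith [mul_le_mul_of_nonneg_left
      (show t ≤ cdfOf p a - cdfOf q a - (empCDF ω.1 a - empCDF ω.2 a) by linarith)
      (n.cast_nonneg : (0 : ℝ) ≤ n)]
  · refine le_trans (measureReal_mono fun ω hω => ?_) (hG.measure_ge_le (by positivity))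
    have h := (abs_le.mp ((abs_empCDF_sub_le_ksDistSeq ω.1 ω.2 a).trans hω)).1
    simp only [Set.mem_ofPred_eq]
    nlinarith [mul_le_mul_of_nonneg_left
      (show t ≤ (empCDF ω.1 a - empCDF ω.2 a) - (cdfOf p a - cdfOf q a) by linarith)
      (n.cast_nonneg : (0 : ℝ) ≤ n)]

/-- Lemma: inter-cluster separation of the KS distance.
If `P₁, P₂` are sets of probability distributions on ℝ with
`inf_{p∈P₁,p'∈P₂} d_KS(p,p') = d_H > 0`, and `x₁, x₂` are independent sequences of `n`
i.i.d. samples from `p₁ ∈ P₁` and `p₂ ∈ P₂` respectively, then for every `0 < d₀ < d_H`,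
`P(d_KS(x₁,x₂) ≤ d₀) ≤ 4 exp(-n (d_H - d₀)^2 / 2)`. -/
theorem stmt1 (P₁ P₂ : Set (Measure ℝ))
    (hP₁ : ∀ p ∈ P₁, IsProbabilityMeasure p) (hP₂ : ∀ p ∈ P₂, IsProbabilityMeasure p)
    (dH : ℝ) (hsep : sInf {r : ℝ | ∃ p ∈ P₁, ∃ q ∈ P₂, r = ksDist p q} = dH) (hdH : 0 < dH)
    (n : ℕ) (p₁ p₂ : Measure ℝ) (hp₁ : p₁ ∈ P₁) (hp₂ : p₂ ∈ P₂)
    (d₀ : ℝ) (hd₀pos : 0 < d₀) (hd₀ : d₀ < dH) :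
    ((Measure.pi fun _ : Fin n => p₁).prod (Measure.pi fun _ : Fin n => p₂))
        {ω : (Fin n → ℝ) × (Fin n → ℝ) | ksDistSeq ω.1 ω.2 ≤ d₀}
      ≤ ENNReal.ofReal (4 * Real.exp (-((n : ℝ) * (dH - d₀) ^ 2) / 2)) := by
  have := hP₁ p₁ hp₁
  have := hP₂ p₂ hp₂
  have hle : dH ≤ ksDist p₁ p₂ := by
    rw [← hsep]
    refine csInf_le ⟨0, ?_⟩ ⟨p₁, hp₁, p₂, hp₂, rfl⟩
    rintro _ ⟨p, -, q, -, rfl⟩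
    exact ksDist_nonneg p q
  have hpos : 0 < dH - d₀ := sub_pos.mpr hd₀
  obtain ⟨a, ha⟩ := exists_lt_of_lt_ciSup
    (show d₀ + 3 / 4 * (dH - d₀) < ⨆ a, |cdfOf p₁ a - cdfOf p₂ a| from
      lt_of_lt_of_le (by linarith) hle)
  rw [← ofReal_measureReal]
  refine ENNReal.ofReal_le_ofReal
    ((measureReal_ksDistSeq_le n p₁ p₂ (by positivity) ha.le).trans ?_)
  have hexp : Real.exp (-(n * (3 / 4 * (dH - d₀)) ^ 2)) ≤
      Real.exp (-((n : ℝ) * (dH - d₀) ^ 2) / 2) := by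
    refine Real.exp_le_exp.mpr ?_
    have : 0 ≤ (n : ℝ) * (dH - d₀) ^ 2 := by positivity
    nlinarith
  linarith [Real.exp_pos (-((n : ℝ) * (dH - d₀) ^ 2) / 2)]
end

section
/- Let x₁ and x₂ be sequences of n samples in ℝ^m and let x₂' agree with x₂ except possibly in one coordinate, which is replaced by an arbitrary point x̃ ∈ ℝ^m. If the kernel g satisfies 0 ≤ g(x,y) ≤ 𝕂, then |MMD²(x₁,x₂) − MMD²(x₁,x₂')| ≤ 8𝕂/n, where MMD² denotes the unbiased estimator between sequences. -/
open MeasureTheory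
open scoped Classical

/-- The unbiased estimator of squared MMD between a sequence `x` of `n` samples and a
sequence `y` of `m` samples, for the kernel `g`:
`(1/(n(n−1))) Σ_{i≠j} g(x i, x j) + (1/(m(m−1))) Σ_{i≠j} g(y i, y j)
  − (2/(nm)) Σ_{i,j} g(x i, y j)`. -/
noncomputable def mmdSqEst {E : Type*} (g : E → E → ℝ) {n m : ℕ}
    (x : Fin n → E) (y : Fin m → E) : ℝ :=
  (∑ i, ∑ j ∈ Finset.univ.erase i, g (x i) (x j)) / ((n : ℝ) * ((n : ℝ) - 1))
    + (∑ i, ∑ j ∈ Finset.univ.erase i, g (y i) (y j)) / ((m : ℝ) * ((m : ℝ) - 1))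
    - 2 * (∑ i, ∑ j, g (x i) (y j)) / ((n : ℝ) * (m : ℝ))

/-- The squared MMD between two distributions, `‖μ_p − μ_q‖²`, expressed through a feature
map `φ` into a Hilbert space (`μ_p = E_p[φ]` is the mean embedding of `p`). -/
noncomputable def mmdSqDist {E : Type*} [MeasurableSpace E] {H : Type*}
    [NormedAddCommGroup H] [InnerProductSpace ℝ H] (φ : E → H) (p q : Measure E) : ℝ :=
  ‖(∫ z, φ z ∂p) - (∫ z, φ z ∂q)‖ ^ 2

/-- A difference of kernel values is bounded by the kernel's upper bound. -/
theorem abs_kernel_sub_le {E : Type*} {g : E → E → ℝ} {C : ℝ}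
    (hg : ∀ x y, 0 ≤ g x y ∧ g x y ≤ C) (a b c d : E) : |g a b - g c d| ≤ C := by
  rw [abs_le]
  constructor <;> linarith [hg a b, hg c d]

/-- Changing one sample changes the off-diagonal kernel sum by at most `2 (n - 1) C`. -/
theorem abs_sum_offDiag_sub_update_le {E : Type*} {g : E → E → ℝ} {C : ℝ}
    (hg : ∀ x y, 0 ≤ g x y ∧ g x y ≤ C) {n : ℕ} (y : Fin n → E) (k : Fin n) (z : E) :
    |(∑ i, ∑ j ∈ Finset.univ.erase i, g (y i) (y j)) -
      ∑ i, ∑ j ∈ Finset.univ.erase i, g (Function.update y k z i) (Function.update y k z j)|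
      ≤ 2 * ((n : ℝ) - 1) * C := by
  have hC : 0 ≤ C := (hg z z).1.trans (hg z z).2
  have hn : 1 ≤ n := Fin.pos k
  simp only [← Finset.sum_sub_distrib]
  calc _ ≤ ∑ i, ∑ j ∈ Finset.univ.erase i,
        ((if i = k then C else 0) + (if j = k then C else 0)) := by
        refine (Finset.abs_sum_le_sum_abs _ _).trans (Finset.sum_le_sum fun i _ => ?_)
        refine (Finset.abs_sum_le_sum_abs _ _).trans (Finset.sum_le_sum fun j _ => ?_)
        have h := abs_kernel_sub_le hg (y i) (y j) (Function.update y k z i)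
          (Function.update y k z j)
        by_cases hi : i = k
        · rw [if_pos hi]
          split_ifs <;> linarith
        · by_cases hj : j = k
          · rw [if_neg hi, if_pos hj]
            linarith
          · simp [hi, hj]
    _ = 2 * ((n : ℝ) - 1) * C := by
        have h1 : ∀ i : Fin n, ∑ j ∈ Finset.univ.erase i,
            ((if i = k then C else 0) + (if j = k then C else 0))
            = (((n : ℝ) - 1) * (if i = k then C else 0)) +
              (C - if i = k then C else 0) := by
          intro i
          rw [Finset.sum_add_distrib, Finset.sum_const,
            Finset.card_erase_of_mem (Finset.mem_univ i), Finset.card_univ, Fintype.card_fin,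
            nsmul_eq_mul, Nat.cast_sub hn, Nat.cast_one,
            Finset.sum_erase_eq_sub (Finset.mem_univ i)]
          simp
        simp only [h1, Finset.sum_add_distrib, Finset.sum_sub_distrib, ← Finset.mul_sum]
        simp
        ring

/-- Changing one sample of `y` changes the cross kernel sum by at most `n C`. -/
theorem abs_sum_cross_sub_update_le {E : Type*} {g : E → E → ℝ} {C : ℝ}
    (hg : ∀ x y, 0 ≤ g x y ∧ g x y ≤ C) {n m : ℕ} (x : Fin n → E) (y : Fin m → E)
    (k : Fin m) (z : E) :
    |(∑ i, ∑ j, g (x i) (y j)) - ∑ i, ∑ j, g (x i) (Function.update y k z j)| ≤ n * C := by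
  simp only [← Finset.sum_sub_distrib]
  calc _ ≤ ∑ _i : Fin n, C := by
        refine (Finset.abs_sum_le_sum_abs _ _).trans (Finset.sum_le_sum fun i _ => ?_)
        rw [Finset.sum_eq_single k (fun j _ hj => by simp [hj]) (by simp)]
        exact abs_kernel_sub_le hg _ _ _ _
    _ = n * C := by simp

/-- bounded differences for the unbiased MMD² estimator.
If `x₁, x₂` are sequences of `n` samples in `ℝ^m`, `x₂'` agrees with `x₂` except possibly
in one coordinate (replaced by an arbitrary point `xt`), and `0 ≤ g ≤ 𝕂`, then
`|MMD²(x₁,x₂) − MMD²(x₁,x₂')| ≤ 8𝕂/n`. -/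
theorem stmt6 {m : ℕ} (g : (Fin m → ℝ) → (Fin m → ℝ) → ℝ) (𝕂 : ℝ)
    (hg : ∀ x y, 0 ≤ g x y ∧ g x y ≤ 𝕂)
    {n : ℕ} (x₁ x₂ : Fin n → (Fin m → ℝ)) (γ : Fin n) (xt : Fin m → ℝ) :
    |mmdSqEst g x₁ x₂ - mmdSqEst g x₁ (Function.update x₂ γ xt)| ≤ 8 * 𝕂 / (n : ℝ) := by
  have hK : 0 ≤ 𝕂 := (hg xt xt).1.trans (hg xt xt).2
  have hn : 1 ≤ n := Fin.pos γ
  have hn0 : (0 : ℝ) < n := by exact_mod_cast hn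
  have hn1 : (0 : ℝ) ≤ (n : ℝ) - 1 := sub_nonneg.2 (by exact_mod_cast hn)
  have hA := abs_sum_offDiag_sub_update_le hg x₂ γ xt
  have hB := abs_sum_cross_sub_update_le hg x₁ x₂ γ xt
  unfold mmdSqEst
  set A := ∑ i, ∑ j ∈ Finset.univ.erase i, g (x₂ i) (x₂ j)
  set A' := ∑ i, ∑ j ∈ Finset.univ.erase i,
    g (Function.update x₂ γ xt i) (Function.update x₂ γ xt j)
  set B := ∑ i, ∑ j, g (x₁ i) (x₂ j)
  set B' := ∑ i, ∑ j, g (x₁ i) (Function.update x₂ γ xt j)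
  have h1 : |(A - A') / ((n : ℝ) * ((n : ℝ) - 1))| ≤ 2 * 𝕂 / n := by
    rw [abs_div, abs_of_nonneg (mul_nonneg hn0.le hn1)]
    rcases hn1.eq_or_lt with h | h
    · rw [← h, mul_zero, div_zero]
      positivity
    · rw [div_le_div_iff₀ (mul_pos hn0 h) hn0]
      nlinarith [mul_le_mul_of_nonneg_right hA hn0.le]
  have h2 : |2 * (B - B') / ((n : ℝ) * n)| ≤ 2 * 𝕂 / n := by
    rw [abs_div, abs_mul, abs_two, abs_of_pos (mul_pos hn0 hn0),
      div_le_div_iff₀ (mul_pos hn0 hn0) hn0]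
    nlinarith [mul_le_mul_of_nonneg_right hB hn0.le]
  calc _ = |(A - A') / ((n : ℝ) * ((n : ℝ) - 1)) - 2 * (B - B') / ((n : ℝ) * n)| := by
        congr 1
        ring
    _ ≤ 2 * 𝕂 / n + 2 * 𝕂 / n := (abs_sub _ _).trans (add_le_add h1 h2)
    _ ≤ 8 * 𝕂 / n := by
        rw [← add_div]
        gcongr
        linarith
end

section
/- Let x be a sequence of n i.i.d. samples from a distribution p and y an independent sequence of m i.i.d. samples from a distribution q, with a kernel g whose mean embeddings μ_p, μ_q exist (in particular when 0 ≤ g ≤ 𝕂 < ∞). Then the unbiased estimator satisfies E[MMD²(x,y)] = MMD²(p,q) = ||μ_p − μ_q||²_H. -/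
open MeasureTheory
open scoped Classical

/-- For independent `X ∼ p` and `Y ∼ q` and a bounded kernel with feature map `φ`, the variable
`g X Y` is integrable with expectation `⟪μ_p, μ_q⟫`. -/
theorem MeasureTheory.MeasurePreserving.kernel_integrable_and_integral_eq
    {Ω E H : Type*} [MeasurableSpace Ω] [MeasurableSpace E]
    [NormedAddCommGroup H] [InnerProductSpace ℝ H] [CompleteSpace H]
    {g : E → E → ℝ} {φ : E → H} (hgφ : ∀ x y, g x y = inner ℝ (φ x) (φ y))
    (hgmeas : Measurable (Function.uncurry g)) {K : ℝ} (hg : ∀ x y, 0 ≤ g x y ∧ g x y ≤ K)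
    {p q : Measure E} [IsProbabilityMeasure p] [IsProbabilityMeasure q]
    (hφp : Integrable φ p) (hφq : Integrable φ q)
    {P : Measure Ω} {X Y : Ω → E}
    (hXY : MeasurePreserving (fun ω => (X ω, Y ω)) P (p.prod q)) :
    Integrable (fun ω => g (X ω) (Y ω)) P ∧
      ∫ ω, g (X ω) (Y ω) ∂P = inner ℝ (∫ z, φ z ∂p) (∫ z, φ z ∂q) := by
  have hint : Integrable (Function.uncurry g) (p.prod q) := by
    refine Integrable.of_bound hgmeas.aestronglyMeasurable K (.of_forall fun z => ?_)
    rw [Real.norm_eq_abs, Function.uncurry, abs_of_nonneg (hg _ _).1]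
    exact (hg _ _).2
  refine ⟨hXY.integrable_comp_of_integrable hint, ?_⟩
  calc ∫ ω, g (X ω) (Y ω) ∂P
      = ∫ ω, Function.uncurry g (X ω, Y ω) ∂P := rfl
    _ = ∫ z, Function.uncurry g z ∂(p.prod q) := by
        rw [← hXY.map_eq, integral_map hXY.measurable.aemeasurable hgmeas.aestronglyMeasurable]
    _ = ∫ x, ∫ y, inner ℝ (φ x) (φ y) ∂q ∂p := by
        rw [integral_prod _ hint]
        simp only [Function.uncurry, hgφ]
    _ = ∫ x, inner ℝ (∫ y, φ y ∂q) (φ x) ∂p := by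
        refine integral_congr_ae (.of_forall fun x => ?_)
        simp only [integral_inner hφq, real_inner_comm]
    _ = inner ℝ (∫ z, φ z ∂p) (∫ z, φ z ∂q) := by
        rw [integral_inner hφp, real_inner_comm]

/-- Two distinct coordinates of an i.i.d. sequence have the product law. -/
theorem MeasureTheory.measurePreserving_eval_pair {E ι : Type*} [MeasurableSpace E] [Fintype ι]
    (p : Measure E) [IsProbabilityMeasure p] {i j : ι} (hij : i ≠ j) :
    MeasurePreserving (fun x : ι → E => (x i, x j)) (Measure.pi fun _ => p) (p.prod p) := by
  refine ⟨by fun_prop, ?_⟩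
  have hindep : ProbabilityTheory.iIndepFun (fun (k : ι) (x : ι → E) => x k)
      (Measure.pi fun _ => p) :=
    ProbabilityTheory.iIndepFun_pi (X := fun _ => id) fun _ => aemeasurable_id
  have h := (ProbabilityTheory.indepFun_iff_map_prod_eq_prod_map_map
    (measurable_pi_apply i).aemeasurable (measurable_pi_apply j).aemeasurable).1
    (hindep.indepFun hij)
  rw [h]
  congr 1
  · exact (measurePreserving_eval (fun _ : ι => p) i).map_eq
  · exact (measurePreserving_eval (fun _ : ι => p) j).map_eq

/-- A finite double sum of integrable functions with common integral `c` is integrable, and its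
integral is the double sum of `c`. -/
theorem MeasureTheory.integrable_and_integral_sum_sum_of_integral_eq {Ω ι κ : Type*}
    [MeasurableSpace Ω] {P : Measure Ω} (s : Finset ι) (t : ι → Finset κ)
    {f : ι → κ → Ω → ℝ} {c : ℝ}
    (h : ∀ i ∈ s, ∀ j ∈ t i, Integrable (f i j) P ∧ ∫ ω, f i j ω ∂P = c) :
    Integrable (fun ω => ∑ i ∈ s, ∑ j ∈ t i, f i j ω) P ∧
      ∫ ω, ∑ i ∈ s, ∑ j ∈ t i, f i j ω ∂P = ∑ i ∈ s, ∑ _j ∈ t i, c := by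
  have hi : ∀ i ∈ s, Integrable (fun ω => ∑ j ∈ t i, f i j ω) P := fun i hi =>
    integrable_finsetSum _ fun j hj => (h i hi j hj).1
  refine ⟨integrable_finsetSum _ hi, ?_⟩
  rw [integral_finsetSum _ hi]
  refine Finset.sum_congr rfl fun i hi => ?_
  rw [integral_finsetSum _ fun j hj => (h i hi j hj).1]
  exact Finset.sum_congr rfl fun j hj => (h i hi j hj).2

/-- There are `n (n - 1)` off-diagonal pairs in `Fin n`. -/
theorem Fin.sum_sum_erase_const (n : ℕ) (hn : 1 ≤ n) (c : ℝ) :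
    ∑ i : Fin n, ∑ _j ∈ Finset.univ.erase i, c = (n : ℝ) * ((n : ℝ) - 1) * c := by
  simp [Finset.card_erase_of_mem, Nat.cast_sub hn, mul_assoc]

/-- unbiasedness of the MMD² estimator.
If `x` is a sequence of `n ≥ 2` i.i.d. samples from `p` and `y` an independent sequence of
`m ≥ 2` i.i.d. samples from `q`, with a kernel `g` (with feature map `φ` into a Hilbert
space, `0 ≤ g ≤ 𝕂`) whose mean embeddings `μ_p, μ_q` exist, then
`E[MMD²(x,y)] = MMD²(p,q) = ‖μ_p − μ_q‖²`. -/
theorem stmt7 {d : ℕ} {H : Type*} [NormedAddCommGroup H] [InnerProductSpace ℝ H]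
    [CompleteSpace H]
    (g : (Fin d → ℝ) → (Fin d → ℝ) → ℝ) (φ : (Fin d → ℝ) → H)
    (hgφ : ∀ x y, g x y = @inner ℝ H _ (φ x) (φ y))
    (hgmeas : Measurable (Function.uncurry g))
    (𝕂 : ℝ) (hg : ∀ x y, 0 ≤ g x y ∧ g x y ≤ 𝕂)
    (p q : Measure (Fin d → ℝ)) [IsProbabilityMeasure p] [IsProbabilityMeasure q]
    (hφp : Integrable φ p) (hφq : Integrable φ q)
    {n m : ℕ} (hn : 2 ≤ n) (hm : 2 ≤ m) :
    (∫ ω : (Fin n → (Fin d → ℝ)) × (Fin m → (Fin d → ℝ)),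
          mmdSqEst g ω.1 ω.2
          ∂((Measure.pi fun _ : Fin n => p).prod (Measure.pi fun _ : Fin m => q)))
        = mmdSqDist φ p q ∧
    mmdSqDist φ p q = ‖(∫ z, φ z ∂p) - (∫ z, φ z ∂q)‖ ^ 2 := by
  refine ⟨?_, rfl⟩
  set P := (Measure.pi fun _ : Fin n => p).prod (Measure.pi fun _ : Fin m => q)
  obtain ⟨ixx, exx⟩ := integrable_and_integral_sum_sum_of_integral_eq (P := P)
    (Finset.univ : Finset (Fin n)) (fun i => Finset.univ.erase i)
    (f := fun i j ω => g (ω.1 i) (ω.1 j)) fun i _ j hj =>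
      ((measurePreserving_eval_pair p (Finset.ne_of_mem_erase hj).symm).comp
        measurePreserving_fst).kernel_integrable_and_integral_eq hgφ hgmeas hg hφp hφp
  obtain ⟨iyy, eyy⟩ := integrable_and_integral_sum_sum_of_integral_eq (P := P)
    (Finset.univ : Finset (Fin m)) (fun i => Finset.univ.erase i)
    (f := fun i j ω => g (ω.2 i) (ω.2 j)) fun i _ j hj =>
      ((measurePreserving_eval_pair q (Finset.ne_of_mem_erase hj).symm).comp
        measurePreserving_snd).kernel_integrable_and_integral_eq hgφ hgmeas hg hφq hφq
  obtain ⟨ixy, exy⟩ := integrable_and_integral_sum_sum_of_integral_eq (P := P)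
    (Finset.univ : Finset (Fin n)) (fun _ => (Finset.univ : Finset (Fin m)))
    (f := fun i j ω => g (ω.1 i) (ω.2 j)) fun i _ j _ =>
      ((measurePreserving_eval (fun _ => p) i).prod
        (measurePreserving_eval (fun _ => q) j)).kernel_integrable_and_integral_eq
        hgφ hgmeas hg hφp hφq
  rw [Fin.sum_sum_erase_const _ (by omega)] at exx eyy
  simp only [mmdSqEst]
  rw [integral_sub ((ixx.div_const _).fun_add (iyy.div_const _)) ((ixy.const_mul 2).div_const _),
    integral_add (ixx.div_const _) (iyy.div_const _), integral_div, integral_div, integral_div,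
    integral_const_mul, exx, eyy, exy, mmdSqDist, norm_sub_sq_real,
    ← real_inner_self_eq_norm_sq, ← real_inner_self_eq_norm_sq]
  have hn' : (2 : ℝ) ≤ n := by exact_mod_cast hn
  have hm' : (2 : ℝ) ≤ m := by exact_mod_cast hm
  have hn0 : (n : ℝ) ≠ 0 := by linarith
  have hm0 : (m : ℝ) ≠ 0 := by linarith
  have hn1 : (n : ℝ) - 1 ≠ 0 := by linarith
  have hm1 : (m : ℝ) - 1 ≠ 0 := by linarith
  simp only [Finset.sum_const, Finset.card_univ, Fintype.card_fin, nsmul_eq_mul]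
  field_simp
  ring
end
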